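/- arXiv:1903.04142 — 3 statements merged into one kernel-verified Lean document; each statement's English description precedes it below -/
import Mathlib

section
/- Let μ > 0 and r ∈ ℤ⁺, and let θ ∈ [0,1] be such that (1−θ)r ∈ ℤ⁺. Then there exists C > 0 such that for every sufficiently regular and decaying f : ℝ → ℂ, ‖ ⟨x⟩^{θμ} ∂_x^{(1−θ)r} f ‖_{L²} ≤ C ‖⟨x⟩^μ f‖_{L²}^θ ‖∂_x^r f‖_{L²}^{1−θ} + L.O.T., where the lower-order terms L.O.T. are bounded by C Σ ‖ ⟨x⟩^{β(μ−1)} ∂_x^{(1−β)(r−1)} f ‖_{L²}, the sum running over all β ∈ [0,1] with (1−β)(r−1) ∈ ℤ⁺. -/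
open MeasureTheory Filter Set
open scoped ENNReal NNReal FourierTransform

noncomputable section

/-- Japanese bracket `⟨x⟩ = (1+x²)^{1/2}`. -/
def jap (x : ℝ) : ℝ := Real.sqrt (1 + x ^ 2)

/-- `L²(ℝ)` norm (as a real number). -/
def L2 (g : ℝ → ℂ) : ℝ := (eLpNorm g 2 volume).toReal

/-- `L^∞(ℝ)` norm (as a real number). -/
def Linf (g : ℝ → ℂ) : ℝ := (eLpNorm g ⊤ volume).toReal

/-- The linear group `U_j(t) = e^{-t ∂_x^{2j+1}}` defined via the Fourier transform. -/
def Uop (j : ℕ) (t : ℝ) (f : ℝ → ℂ) : ℝ → ℂ :=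
  fun x => 𝓕⁻ (fun ξ : ℝ => Complex.exp (-(t : ℂ) * (Complex.I * ξ) ^ (2 * j + 1)) * 𝓕 f ξ) x


theorem hasTemperateGrowth_one_add_sq_rpow (c : ℝ) :
    (fun x : ℝ ↦ (1 + x ^ 2) ^ c).HasTemperateGrowth := by
  simpa using Function.hasTemperateGrowth_one_add_norm_sq_rpow ℝ c

theorem hasTemperateGrowth_add_one_add_sq_rpow {Λ : ℝ} (hΛ : 0 < Λ) (c : ℝ) :
    (fun x : ℝ ↦ (Λ + (1 + x ^ 2)) ^ c).HasTemperateGrowth := by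
  have hlin : (fun x : ℝ ↦ (√(1 + Λ))⁻¹ * x).HasTemperateGrowth := by fun_prop
  have h := (Function.HasTemperateGrowth.const ((1 + Λ) ^ c) (E := ℝ)).mul
    ((hasTemperateGrowth_one_add_sq_rpow c).comp hlin)
  convert! h using 1
  ext x
  simp only [Pi.mul_apply, Function.comp_apply, mul_pow, inv_pow]
  rw [Real.sq_sqrt (by positivity), ← Real.mul_rpow (by positivity) (by positivity)]
  congr 1
  field_simp
  ring

theorem integrable_mul_inner {φ : ℝ → ℝ} (hφ : φ.HasTemperateGrowth) (g h : SchwartzMap ℝ ℂ) :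
    Integrable (fun x ↦ φ x * inner ℝ (g x) (h x)) := by
  have hg := ((SchwartzMap.smulLeftCLM ℂ φ g).memLp 2 volume)
  have := MeasureTheory.L2.integrable_inner (𝕜 := ℝ) (hg.toLp _) ((h.memLp 2 volume).toLp _)
  refine this.congr ?_
  filter_upwards [hg.coeFn_toLp, (h.memLp 2 volume).coeFn_toLp] with x h1 h2
  rw [h1, h2, SchwartzMap.smulLeftCLM_apply_apply hφ, real_inner_smul_left]

theorem integral_deriv_mul_inner {φ φ' : ℝ → ℝ} (hφ : φ.HasTemperateGrowth)
    (hφ' : φ'.HasTemperateGrowth) (hd : ∀ x, HasDerivAt φ (φ' x) x)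
    (g g' h h' : SchwartzMap ℝ ℂ) (hg : ∀ x, HasDerivAt g (g' x) x)
    (hh : ∀ x, HasDerivAt h (h' x) x) :
    (∫ x, φ' x * inner ℝ (g x) (h x)) + ((∫ x, φ x * inner ℝ (g x) (h' x))
      + ∫ x, φ x * inner ℝ (g' x) (h x)) = 0 := by
  have i1 := integrable_mul_inner hφ' g h
  have i2 := integrable_mul_inner hφ g h'
  have i3 := integrable_mul_inner hφ g' h
  have i23 : Integrable (fun x ↦ φ x * inner ℝ (g x) (h' x) + φ x * inner ℝ (g' x) (h x)) :=
    i2.add i3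
  rw [← integral_add i2 i3, ← integral_add i1 i23]
  refine integral_eq_zero_of_hasDerivAt_of_integrable (f := fun x ↦ φ x * inner ℝ (g x) (h x))
    (fun x ↦ ?_) (i1.add i23) (integrable_mul_inner hφ g h)
  convert! (hd x).mul ((hg x).inner ℝ (hh x)) using 1
  ring

/-- The `n`-th derivative of a Schwartz function, as a Schwartz function. -/
def schwartzDeriv (f : SchwartzMap ℝ ℂ) (n : ℕ) : SchwartzMap ℝ ℂ :=
  (SchwartzMap.derivCLM ℝ ℂ)^[n] f

theorem coe_schwartzDeriv (f : SchwartzMap ℝ ℂ) (n : ℕ) :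
    ⇑(schwartzDeriv f n) = iteratedDeriv n f := by
  induction n with
  | zero => simp [schwartzDeriv]
  | succ n ih =>
    rw [iteratedDeriv_succ, ← ih]
    ext x
    simp [schwartzDeriv, Function.iterate_succ_apply']

theorem hasDerivAt_schwartzDeriv (f : SchwartzMap ℝ ℂ) (n : ℕ) (x : ℝ) :
    HasDerivAt (schwartzDeriv f n) (schwartzDeriv f (n + 1) x) x := by
  rw [coe_schwartzDeriv f (n + 1), iteratedDeriv_succ, ← coe_schwartzDeriv]
  exact (schwartzDeriv f n).differentiableAt.hasDerivAt

theorem L2_jap_rpow_mul_sq (c : ℝ) (g : SchwartzMap ℝ ℂ) :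
    L2 (fun x ↦ ((jap x ^ c : ℝ) : ℂ) * g x) ^ 2
      = ∫ x, (1 + x ^ 2) ^ c * inner ℝ (g x) (g x) := by
  have hφ := hasTemperateGrowth_one_add_sq_rpow (c / 2)
  have hj (x : ℝ) : jap x ^ c = (1 + x ^ 2) ^ (c / 2) := by
    rw [jap, Real.sqrt_eq_rpow, ← Real.rpow_mul (by positivity)]
    ring_nf
  have he : (fun x ↦ ((jap x ^ c : ℝ) : ℂ) * g x) =
      SchwartzMap.smulLeftCLM ℂ (fun x : ℝ ↦ (1 + x ^ 2) ^ (c / 2)) g := by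
    ext x
    rw [SchwartzMap.smulLeftCLM_apply_apply hφ, hj, Complex.real_smul]
  rw [he, L2, ← SchwartzMap.norm_toLp, ← real_inner_self_eq_norm_sq, MeasureTheory.L2.inner_def]
  refine integral_congr_ae ?_
  filter_upwards [(SchwartzMap.smulLeftCLM ℂ (fun x : ℝ ↦ (1 + x ^ 2) ^ (c / 2)) g).coeFn_toLp 2
    volume] with x hx
  rw [hx, SchwartzMap.smulLeftCLM_apply_apply hφ, real_inner_smul_left, real_inner_smul_right,
    ← mul_assoc, ← Real.rpow_add (by positivity), add_halves]

theorem abs_integral_mul_inner_le {w α β : ℝ → ℝ} (hw : w.HasTemperateGrowth)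
    (hα : α.HasTemperateGrowth) (hβ : β.HasTemperateGrowth) (hα0 : ∀ x, 0 ≤ α x)
    (hβ0 : ∀ x, 0 ≤ β x) (h : ∀ x, w x ^ 2 ≤ α x * β x) (u v : SchwartzMap ℝ ℂ) :
    |∫ x, w x * inner ℝ (u x) (v x)| ≤
      ((∫ x, α x * inner ℝ (u x) (u x)) + ∫ x, β x * inner ℝ (v x) (v x)) / 2 := by
  have i1 := integrable_mul_inner hα u u
  have i2 := integrable_mul_inner hβ v v
  rw [← integral_add i1 i2, ← integral_div]
  refine (abs_integral_le_integral_abs).trans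
    (integral_mono (integrable_mul_inner hw u v).abs ((i1.add i2).div_const 2) fun x ↦ ?_)
  simp only [real_inner_self_eq_norm_sq, abs_mul]
  have h1 : |w x| ≤ √(α x) * √(β x) := by
    rw [← Real.sqrt_mul (hα0 x)]
    exact Real.abs_le_sqrt (h x)
  have h2 := abs_real_inner_le_norm (u x) (v x)
  calc |w x| * |inner ℝ (u x) (v x)| ≤ (√(α x) * √(β x)) * (‖u x‖ * ‖v x‖) := by gcongr
    _ ≤ (√(α x) ^ 2 * ‖u x‖ ^ 2 + √(β x) ^ 2 * ‖v x‖ ^ 2) / 2 := by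
      nlinarith [sq_nonneg (√(α x) * ‖u x‖ - √(β x) * ‖v x‖)]
    _ = _ := by rw [Real.sq_sqrt (hα0 x), Real.sq_sqrt (hβ0 x)]

theorem integral_mul_inner_self_mono {α β : ℝ → ℝ} (hα : α.HasTemperateGrowth)
    (hβ : β.HasTemperateGrowth) (h : ∀ x, α x ≤ β x) (u : SchwartzMap ℝ ℂ) :
    ∫ x, α x * inner ℝ (u x) (u x) ≤ ∫ x, β x * inner ℝ (u x) (u x) :=
  integral_mono (integrable_mul_inner hα u u) (integrable_mul_inner hβ u u)
    fun x ↦ mul_le_mul_of_nonneg_right (h x) real_inner_self_nonneg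

theorem hasDerivAt_one_add_sq_rpow (c x : ℝ) :
    HasDerivAt (fun x : ℝ ↦ (1 + x ^ 2) ^ c) (2 * x * (c * (1 + x ^ 2) ^ (c - 1))) x := by
  have h : HasDerivAt (fun x : ℝ ↦ 1 + x ^ 2) (2 * x) x := by
    simpa using (hasDerivAt_pow 2 x).const_add 1
  convert! h.rpow_const (p := c) (Or.inl (by positivity)) using 1
  ring

theorem hasDerivAt_add_one_add_sq_rpow {Λ : ℝ} (hΛ : 0 < Λ) (c x : ℝ) :
    HasDerivAt (fun x : ℝ ↦ (Λ + (1 + x ^ 2)) ^ c)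
      (2 * x * (c * (Λ + (1 + x ^ 2)) ^ (c - 1))) x := by
  have h : HasDerivAt (fun x : ℝ ↦ Λ + (1 + x ^ 2)) (2 * x) x := by
    simpa using ((hasDerivAt_pow 2 x).const_add 1).const_add Λ
  convert! h.rpow_const (p := c) (Or.inl (by positivity)) using 1
  ring

theorem rpow_le_mul_sum_rpow_div {J Λ a m : ℝ} (hJ : 0 < J) (hΛ : 0 < Λ) (hm : 0 ≤ m) :
    J ^ a ≤ 2 ^ m * (Λ ^ m * (J ^ a * (Λ + J) ^ (-m)) + J ^ (a + m) * (Λ + J) ^ (-m)) := by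
  have key : (Λ + J) ^ m ≤ 2 ^ m * (Λ ^ m + J ^ m) := by
    rcases le_total Λ J with h | h
    · calc (Λ + J) ^ m ≤ (2 * J) ^ m := by gcongr; linarith
        _ = 2 ^ m * J ^ m := Real.mul_rpow (by norm_num) hJ.le
        _ ≤ _ := by gcongr; linarith [Real.rpow_nonneg hΛ.le m]
    · calc (Λ + J) ^ m ≤ (2 * Λ) ^ m := by gcongr; linarith
        _ = 2 ^ m * Λ ^ m := Real.mul_rpow (by norm_num) hΛ.le
        _ ≤ _ := by gcongr; linarith [Real.rpow_nonneg hJ.le m]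
  have hD : 0 < (Λ + J) ^ m := by positivity
  rw [Real.rpow_neg (by positivity), Real.rpow_add hJ]
  calc J ^ a = J ^ a * ((Λ + J) ^ m * ((Λ + J) ^ m)⁻¹) := by field_simp
    _ ≤ J ^ a * ((2 ^ m * (Λ ^ m + J ^ m)) * ((Λ + J) ^ m)⁻¹) := by gcongr
    _ = _ := by ring

theorem sq_deriv_weight_le {x Λ a s : ℝ} (hΛ : 0 < Λ) (ha : 0 ≤ a) (hs : 0 ≤ s) :
    (2 * x * ((a + (1 + s)) * (1 + x ^ 2) ^ (a + (1 + s) - 1) * (Λ + (1 + x ^ 2)) ^ (-(1 + s))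
      - (1 + s) * (1 + x ^ 2) ^ (a + (1 + s)) * (Λ + (1 + x ^ 2)) ^ (-(1 + s) - 1))) ^ 2 ≤
    (4 * (a + (1 + s)) ^ 2 * (Λ ^ (-(1 + s)) * (1 + x ^ 2) ^ (a + s))) *
      ((1 + x ^ 2) ^ (a + (1 + s)) * (Λ + (1 + x ^ 2)) ^ (-(1 + s))) := by
  obtain ⟨J, hJ⟩ : ∃ J, J = 1 + x ^ 2 := ⟨_, rfl⟩
  have hJ0 : 0 < J := by rw [hJ]; positivity
  rw [← hJ]
  obtain ⟨m, hm⟩ : ∃ m, m = 1 + s := ⟨_, rfl⟩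
  have hs' : a + s = a + m - 1 := by rw [hm]; ring
  rw [hs', ← hm]
  have hm0 : 0 ≤ m := by linarith
  obtain ⟨E, hE⟩ : ∃ E, E = J ^ (a + m - 1) := ⟨_, rfl⟩
  have hE0 : 0 < E := by rw [hE]; positivity
  have hEJ : J ^ (a + m) = E * J := by
    rw [hE, ← Real.rpow_add_one hJ0.ne']; ring_nf
  obtain ⟨F, hF⟩ : ∃ F, F = (Λ + J) ^ (-m) := ⟨_, rfl⟩
  have hF0 : 0 < F := by rw [hF]; positivity
  have hFD : (Λ + J) ^ (-m - 1) = F / (Λ + J) := by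
    rw [hF, Real.rpow_sub_one (by positivity)]
  have hFΛ : F ≤ Λ ^ (-m) := by
    rw [hF]
    exact Real.rpow_le_rpow_of_nonpos hΛ (by linarith) (by linarith)
  rw [hEJ, hFD, ← hE, ← hF]
  have ht0 : 0 ≤ J / (Λ + J) := by positivity
  have ht1 : J / (Λ + J) ≤ 1 := by rw [div_le_one (by positivity)]; linarith
  have e : (a + m) * E * F - m * (E * J) * (F / (Λ + J))
      = E * F * (a + m - m * (J / (Λ + J))) := by ring
  rw [e]
  have hb : (a + m - m * (J / (Λ + J))) ^ 2 ≤ (a + m) ^ 2 :=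
    pow_le_pow_left₀ (by nlinarith) (by nlinarith) 2
  calc (2 * x * (E * F * (a + m - m * (J / (Λ + J))))) ^ 2
      = 4 * (E ^ 2 * F) * (x ^ 2 * (a + m - m * (J / (Λ + J))) ^ 2 * F) := by ring
    _ ≤ 4 * (E ^ 2 * F) * (J * (a + m) ^ 2 * Λ ^ (-m)) := by
      gcongr
      linarith
    _ = _ := by ring

theorem sq_weight_le {J Λ a s : ℝ} (hJ : 0 < J) (hΛ : 0 < Λ) (hs : 0 ≤ s) :
    (J ^ (a + (1 + s)) * (Λ + J) ^ (-(1 + s))) ^ 2 ≤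
      (Λ ^ (-(1 + s)) * J ^ (a + s)) * (Λ ^ (1 + s) * J ^ (a - s)) := by
  have h1 : J ^ (1 + s) * (Λ + J) ^ (-(1 + s)) ≤ 1 := by
    rw [Real.rpow_neg (by positivity), ← div_eq_mul_inv, div_le_one (by positivity)]
    gcongr
    linarith
  have e : (Λ ^ (-(1 + s)) * J ^ (a + s)) * (Λ ^ (1 + s) * J ^ (a - s)) = (J ^ a) ^ 2 := by
    rw [Real.rpow_neg hΛ.le, Real.rpow_add hJ, Real.rpow_sub hJ]
    field_simp
  rw [e, Real.rpow_add hJ, mul_assoc]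
  gcongr
  exact mul_le_of_le_one_right (by positivity) h1

theorem sq_hardy_weight_le {x Λ a s : ℝ} (hΛ : 0 < Λ) (hs : 0 ≤ s) :
    (Λ ^ (1 + s) * (x * ((1 + x ^ 2) ^ a * (Λ + (1 + x ^ 2)) ^ (-(1 + s))))) ^ 2 ≤
      (1 / 4 * (Λ ^ (1 + s) * ((1 + x ^ 2) ^ a * (Λ + (1 + x ^ 2)) ^ (-(1 + s))))) *
        (4 * (Λ ^ (1 + s) * (1 + x ^ 2) ^ (a - s))) := by
  obtain ⟨J, hJ⟩ : ∃ J, J = 1 + x ^ 2 := ⟨_, rfl⟩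
  have hJ0 : 0 < J := by rw [hJ]; positivity
  have hxJ : x ^ 2 ≤ J := by linarith
  rw [← hJ]
  have h1 : J * J ^ s * (Λ + J) ^ (-(1 + s)) ≤ 1 := by
    rw [Real.rpow_neg (by positivity), ← div_eq_mul_inv, div_le_one (by positivity),
      ← Real.rpow_one_add' hJ0.le (by positivity)]
    gcongr
    linarith
  have e : J ^ a = J ^ (a - s) * J ^ s := by rw [← Real.rpow_add hJ0]; ring_nf
  calc (Λ ^ (1 + s) * (x * (J ^ a * (Λ + J) ^ (-(1 + s))))) ^ 2
      = (Λ ^ (1 + s)) ^ 2 * J ^ a * (Λ + J) ^ (-(1 + s)) * J ^ (a - s)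
        * (x ^ 2 * J ^ s * (Λ + J) ^ (-(1 + s))) := by rw [e]; ring
    _ ≤ (Λ ^ (1 + s)) ^ 2 * J ^ a * (Λ + J) ^ (-(1 + s)) * J ^ (a - s) * 1 := by
      gcongr
      exact h1.trans' (by gcongr)
    _ = _ := by ring

theorem le_deriv_hardy_weight {x Λ a m : ℝ} (hΛ : 0 < Λ) (ha : 0 ≤ a) (hm : 1 ≤ m) :
    1 / 2 * (Λ ^ m * ((1 + x ^ 2) ^ a * (Λ + (1 + x ^ 2)) ^ (-m)))
      - 2 * m * (4 * m) ^ m * ((1 + x ^ 2) ^ (a + m) * (Λ + (1 + x ^ 2)) ^ (-m)) ≤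
    Λ ^ m * ((1 + x ^ 2) ^ a * (Λ + (1 + x ^ 2)) ^ (-m)
      + 2 * x ^ 2 * (a * (1 + x ^ 2) ^ (a - 1) * (Λ + (1 + x ^ 2)) ^ (-m)
        - m * (1 + x ^ 2) ^ a * (Λ + (1 + x ^ 2)) ^ (-m - 1))) := by
  obtain ⟨J, hJ⟩ : ∃ J, J = 1 + x ^ 2 := ⟨_, rfl⟩
  have hJ0 : 0 < J := by rw [hJ]; positivity
  have hxJ : x ^ 2 ≤ J := by linarith
  rw [← hJ]
  obtain ⟨F, hF⟩ : ∃ F, F = (Λ + J) ^ (-m) := ⟨_, rfl⟩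
  have hF0 : 0 < F := by rw [hF]; positivity
  have hFD : (Λ + J) ^ (-m - 1) = F / (Λ + J) := by
    rw [hF, Real.rpow_sub_one (by positivity)]
  have hΛF : Λ ^ m * F ≤ 1 := by
    rw [hF, Real.rpow_neg (by positivity), ← div_eq_mul_inv, div_le_one (by positivity)]
    gcongr
    linarith
  rw [hFD, ← hF, Real.rpow_add hJ0]
  have hA : 0 < J ^ a := by positivity
  have hL : 0 < Λ ^ m := by positivity
  have ht1 : J / (Λ + J) ≤ 1 := by rw [div_le_one (by positivity)]; linarith
  have hlow : Λ ^ m * F * J ^ a * (1 - 2 * m * (J / (Λ + J))) ≤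
      Λ ^ m * (J ^ a * F + 2 * x ^ 2 * (a * J ^ (a - 1) * F - m * J ^ a * (F / (Λ + J)))) := by
    have h1 : 0 ≤ Λ ^ m * (2 * x ^ 2 * (a * J ^ (a - 1) * F)) := by positivity
    have h2 : x ^ 2 * (2 * m * Λ ^ m * J ^ a * (F / (Λ + J))) ≤
        J * (2 * m * Λ ^ m * J ^ a * (F / (Λ + J))) := by gcongr
    have e : J * (2 * m * Λ ^ m * J ^ a * (F / (Λ + J)))
      = Λ ^ m * F * J ^ a * (2 * m * (J / (Λ + J))) := by ring
    linarith
  refine le_trans ?_ hlow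
  have hT : 0 ≤ 2 * m * (4 * m) ^ m * (J ^ a * J ^ m * F) := by positivity
  have hQA : 0 < Λ ^ m * F * J ^ a := by positivity
  by_cases ht : 2 * m * (J / (Λ + J)) ≤ 1 / 2
  · nlinarith
  · have h3 : Λ + J ≤ 4 * m * J := by
      have : 1 / 2 < 2 * m * J / (Λ + J) := by rw [mul_div_assoc]; linarith
      rw [lt_div_iff₀ (by positivity)] at this
      linarith
    have h4 : 1 ≤ (4 * m) ^ m * (J ^ m * F) := by
      rw [← mul_assoc, ← Real.mul_rpow (by positivity) hJ0.le, hF,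
        Real.rpow_neg (by positivity), ← div_eq_mul_inv, one_le_div (by positivity)]
      gcongr
    have h5 : Λ ^ m * F * J ^ a * (2 * m * (J / (Λ + J))) ≤ 1 * J ^ a * (2 * m * 1) := by
      gcongr
    have h6 : J ^ a * (2 * m) * 1 ≤ J ^ a * (2 * m) * ((4 * m) ^ m * (J ^ m * F)) := by
      gcongr
    nlinarith

theorem integral_weight_mul_sq_deriv_le {a s : ℝ} (ha : 0 ≤ a) (hs : 0 ≤ s) :
    ∃ C : ℝ, 0 < C ∧ ∀ g h k : SchwartzMap ℝ ℂ, (∀ x, HasDerivAt g (h x) x) →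
      (∀ x, HasDerivAt h (k x) x) → ∀ Λ : ℝ, 0 < Λ →
      ∫ x, (1 + x ^ 2) ^ a * inner ℝ (h x) (h x) ≤
        C * (Λ ^ (-(1 + s)) * (∫ x, (1 + x ^ 2) ^ (a + s) * inner ℝ (g x) (g x))
          + Λ ^ (1 + s) * ∫ x, (1 + x ^ 2) ^ (a - s) * inner ℝ (k x) (k x)) := by
  set m : ℝ := 1 + s with hm
  have hm1 : 1 ≤ m := by linarith
  set M : ℝ := 2 * m * (4 * m) ^ m with hM
  have hM0 : 0 < M := by positivity
  set B : ℝ := 4 * (a + m) ^ 2 + 1 with hB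
  have hB1 : 1 ≤ B := by rw [hB]; nlinarith [sq_nonneg (a + m)]
  refine ⟨2 ^ m * ((4 * M + 1) * B + 16), by positivity, fun g h k hg hh Λ hΛ ↦ ?_⟩
  have tJ := hasTemperateGrowth_one_add_sq_rpow
  have tD := hasTemperateGrowth_add_one_add_sq_rpow hΛ
  have tx : (fun x : ℝ ↦ x).HasTemperateGrowth := by fun_prop
  have tc (c : ℝ) : (fun _ : ℝ ↦ c).HasTemperateGrowth := .const c
  set v : ℝ → ℝ := fun x ↦ (1 + x ^ 2) ^ (a + m) * (Λ + (1 + x ^ 2)) ^ (-m) with hv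
  set v' : ℝ → ℝ := fun x ↦ 2 * x * ((a + m) * (1 + x ^ 2) ^ (a + m - 1) *
    (Λ + (1 + x ^ 2)) ^ (-m) - m * (1 + x ^ 2) ^ (a + m) * (Λ + (1 + x ^ 2)) ^ (-m - 1)) with hv'
  set q : ℝ → ℝ := fun x ↦ Λ ^ m * ((1 + x ^ 2) ^ a * (Λ + (1 + x ^ 2)) ^ (-m)) with hq
  set p : ℝ → ℝ := fun x ↦ Λ ^ m * (x * ((1 + x ^ 2) ^ a * (Λ + (1 + x ^ 2)) ^ (-m))) with hp
  set p' : ℝ → ℝ := fun x ↦ Λ ^ m * ((1 + x ^ 2) ^ a * (Λ + (1 + x ^ 2)) ^ (-m)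
      + 2 * x ^ 2 * (a * (1 + x ^ 2) ^ (a - 1) * (Λ + (1 + x ^ 2)) ^ (-m)
        - m * (1 + x ^ 2) ^ a * (Λ + (1 + x ^ 2)) ^ (-m - 1))) with hp'
  have tv : v.HasTemperateGrowth := (tJ _).fun_mul (tD _)
  have tv' : v'.HasTemperateGrowth :=
    ((tc 2).fun_mul tx).fun_mul ((((tc _).fun_mul (tJ _)).fun_mul (tD _)).fun_sub
      (((tc _).fun_mul (tJ _)).fun_mul (tD _)))
  have tq : q.HasTemperateGrowth := (tc _).fun_mul ((tJ _).fun_mul (tD _))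
  have tp : p.HasTemperateGrowth := (tc _).fun_mul (tx.fun_mul ((tJ _).fun_mul (tD _)))
  have tp' : p'.HasTemperateGrowth :=
    (tc _).fun_mul (((tJ _).fun_mul (tD _)).fun_add (((tc 2).fun_mul (tx.fun_pow 2)).fun_mul
      ((((tc _).fun_mul (tJ _)).fun_mul (tD _)).fun_sub
      (((tc _).fun_mul (tJ _)).fun_mul (tD _)))))
  have dv (x : ℝ) : HasDerivAt v (v' x) x := by
    convert! (hasDerivAt_one_add_sq_rpow (a + m) x).mul
      (hasDerivAt_add_one_add_sq_rpow hΛ (-m) x) using 1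
    simp only [hv']
    ring
  have dp (x : ℝ) : HasDerivAt p (p' x) x := by
    convert! ((hasDerivAt_id x).mul ((hasDerivAt_one_add_sq_rpow a x).mul
      (hasDerivAt_add_one_add_sq_rpow hΛ (-m) x))).const_mul (Λ ^ m) using 1
    simp only [hp', Pi.mul_apply, id]
    ring
  have tG0 : (fun x : ℝ ↦ Λ ^ (-m) * (1 + x ^ 2) ^ (a + s)).HasTemperateGrowth :=
    (tc _).fun_mul (tJ _)
  have tG2 : (fun x : ℝ ↦ Λ ^ m * (1 + x ^ 2) ^ (a - s)).HasTemperateGrowth :=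
    (tc _).fun_mul (tJ _)
  have v0 (x : ℝ) : 0 ≤ v x := by positivity
  have q0 (x : ℝ) : 0 ≤ q x := by positivity
  have ibp1 := integral_deriv_mul_inner tv tv' dv g h h k hg hh
  have ibp2 := integral_deriv_mul_inner tp tp' dp h k h k hh hh
  have b1 := abs_integral_mul_inner_le tv'
    ((tc (4 * (a + m) ^ 2)).fun_mul tG0) tv (fun x ↦ by positivity) v0
    (fun x ↦ sq_deriv_weight_le hΛ ha hs) g h
  have b2 := abs_integral_mul_inner_le tv tG0 tG2 (fun x ↦ by positivity) (fun x ↦ by positivity)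
    (fun x ↦ sq_weight_le (by positivity) hΛ hs) g k
  have b3 := abs_integral_mul_inner_le tp ((tc (1 / 4)).fun_mul tq) ((tc 4).fun_mul tG2)
    (fun x ↦ by positivity) (fun x ↦ by positivity) (fun x ↦ sq_hardy_weight_le hΛ hs) h k
  have b4 := integral_mul_inner_self_mono (((tc (1 / 2)).fun_mul tq).fun_sub ((tc M).fun_mul tv))
    tp' (fun x ↦ le_deriv_hardy_weight hΛ ha hm1) h
  have b5 := integral_mul_inner_self_mono (tJ a) ((tc (2 ^ m)).fun_mul (tq.fun_add tv))
    (fun x ↦ rpow_le_mul_sum_rpow_div (by positivity) hΛ (by linarith)) h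
  have comm : ∫ x, p x * inner ℝ (k x) (h x) = ∫ x, p x * inner ℝ (h x) (k x) := by
    simp_rw [real_inner_comm]
  have iq := integrable_mul_inner tq h h
  have iv := integrable_mul_inner tv h h
  have e4 : ∫ x, (1 / 2 * q x - M * v x) * inner ℝ (h x) (h x) =
      1 / 2 * (∫ x, q x * inner ℝ (h x) (h x)) - M * ∫ x, v x * inner ℝ (h x) (h x) := by
    rw [← integral_const_mul, ← integral_const_mul,
      ← integral_sub (iq.const_mul _) (iv.const_mul _)]
    exact integral_congr_ae (ae_of_all _ fun x ↦ by ring)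
  have e5 : ∫ x, 2 ^ m * (q x + v x) * inner ℝ (h x) (h x) =
      2 ^ m * ((∫ x, q x * inner ℝ (h x) (h x)) + ∫ x, v x * inner ℝ (h x) (h x)) := by
    rw [← integral_add iq iv, ← integral_const_mul]
    exact integral_congr_ae (ae_of_all _ fun x ↦ by ring)
  rw [e4] at b4
  rw [e5] at b5
  simp only [mul_assoc, integral_const_mul] at b1 b2 b3
  have n0 : 0 ≤ Λ ^ (-m) * ∫ x, (1 + x ^ 2) ^ (a + s) * inner ℝ (g x) (g x) :=
    mul_nonneg (by positivity) (integral_nonneg fun x ↦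
      mul_nonneg (by positivity) real_inner_self_nonneg)
  have n2 : 0 ≤ Λ ^ m * ∫ x, (1 + x ^ 2) ^ (a - s) * inner ℝ (k x) (k x) :=
    mul_nonneg (by positivity) (integral_nonneg fun x ↦
      mul_nonneg (by positivity) real_inner_self_nonneg)
  generalize Λ ^ (-m) * ∫ x, (1 + x ^ 2) ^ (a + s) * inner ℝ (g x) (g x) = G0 at *
  generalize Λ ^ m * ∫ x, (1 + x ^ 2) ^ (a - s) * inner ℝ (k x) (k x) = G2 at *
  generalize ∫ x, q x * inner ℝ (h x) (h x) = X at *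
  generalize ∫ x, v x * inner ℝ (h x) (h x) = Y at *
  have hY : Y ≤ B * G0 + G2 := by
    rw [hB]
    linarith [(abs_le.mp b1).1, (abs_le.mp b2).1]
  have hX : X ≤ 4 * M * Y + 16 * G2 := by
    linarith [(abs_le.mp b3).1]
  rw [mul_assoc]
  refine b5.trans (mul_le_mul_of_nonneg_left ?_ (by positivity))
  nlinarith [mul_le_mul_of_nonneg_left hY hM0.le, mul_le_mul_of_nonneg_right hB1 n2,
    mul_nonneg hM0.le (mul_le_mul_of_nonneg_right hB1 n2 |> sub_nonneg.mpr)]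

theorem sq_le_two_mul_of_forall_le {C n₀ n₁ n₂ : ℝ} (hC : 0 ≤ C) (h₀ : 0 ≤ n₀) (h₂ : 0 ≤ n₂)
    (h : ∀ t : ℝ, 0 < t → n₁ ^ 2 ≤ C * (t⁻¹ * n₀ ^ 2 + t * n₂ ^ 2)) :
    n₁ ^ 2 ≤ 2 * C * (n₀ * n₂) := by
  have key (ε : ℝ) (hε : 0 < ε) : n₁ ^ 2 ≤ 2 * C * ((n₀ + ε) * (n₂ + ε)) := by
    refine (h ((n₀ + ε) / (n₂ + ε)) (by positivity)).trans ?_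
    calc C * (((n₀ + ε) / (n₂ + ε))⁻¹ * n₀ ^ 2 + (n₀ + ε) / (n₂ + ε) * n₂ ^ 2)
        ≤ C * (((n₀ + ε) / (n₂ + ε))⁻¹ * (n₀ + ε) ^ 2
          + (n₀ + ε) / (n₂ + ε) * (n₂ + ε) ^ 2) := by
          gcongr <;> linarith
      _ = _ := by
        field_simp
        ring
  have hlim : Tendsto (fun ε : ℝ ↦ 2 * C * ((n₀ + ε) * (n₂ + ε))) (nhdsWithin 0 (Ioi 0))
      (nhds (2 * C * ((n₀ + 0) * (n₂ + 0)))) := by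
    refine Tendsto.mono_left (Continuous.tendsto ?_ 0) nhdsWithin_le_nhds
    fun_prop
  simp only [add_zero] at hlim
  exact ge_of_tendsto hlim (eventually_nhdsWithin_of_forall key)

theorem L2_jap_rpow_mul_deriv_sq_le {a s : ℝ} (ha : 0 ≤ a) (hs : 0 ≤ s) :
    ∃ C : ℝ, 0 < C ∧ ∀ g h k : SchwartzMap ℝ ℂ, (∀ x, HasDerivAt g (h x) x) →
      (∀ x, HasDerivAt h (k x) x) →
      L2 (fun x ↦ ((jap x ^ a : ℝ) : ℂ) * h x) ^ 2 ≤
        C * (L2 (fun x ↦ ((jap x ^ (a + s) : ℝ) : ℂ) * g x)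
          * L2 (fun x ↦ ((jap x ^ (a - s) : ℝ) : ℂ) * k x)) := by
  obtain ⟨C, hC, H⟩ := integral_weight_mul_sq_deriv_le ha hs
  refine ⟨2 * C, by positivity, fun g h k hg hh ↦ sq_le_two_mul_of_forall_le hC.le
    ENNReal.toReal_nonneg ENNReal.toReal_nonneg fun t ht ↦ ?_⟩
  have hts : (t ^ (1 + s)⁻¹) ^ (1 + s) = t := Real.rpow_inv_rpow ht.le (by positivity)
  have := H g h k hg hh (t ^ (1 + s)⁻¹) (by positivity)
  rwa [Real.rpow_neg (by positivity), hts, ← L2_jap_rpow_mul_sq, ← L2_jap_rpow_mul_sq,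
    ← L2_jap_rpow_mul_sq] at this

/-- A sequence that is log-convex up to a factor `A` satisfies, up to a constant,
the inequality `N (j + 1) ≤ N 0 ^ (1 / (j + 2)) * N (j + 2) ^ ((j + 1) / (j + 2))`. -/
theorem exists_pow_succ_le_of_sq_le {A : ℝ} (hA : 0 < A) (j : ℕ) :
    ∃ B : ℝ, 0 < B ∧ ∀ N : ℕ → ℝ, (∀ i, 0 ≤ N i) →
      (∀ i ≤ j, N (i + 1) ^ 2 ≤ A * (N i * N (i + 2))) →
      N (j + 1) ^ (j + 2) ≤ B * (N 0 * N (j + 2) ^ (j + 1)) := by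
  induction j with
  | zero => exact ⟨A, hA, fun N _ h ↦ by simpa using h 0 le_rfl⟩
  | succ j ih =>
    obtain ⟨B, hB, ih⟩ := ih
    refine ⟨A ^ (j + 2) * B, by positivity, fun N hN h ↦ ?_⟩
    have h1 := ih N hN fun i hi ↦ h i (by lia)
    have h2 := h (j + 1) le_rfl
    rcases (hN (j + 2)).eq_or_lt with h0 | h0
    · rw [show j + 1 + 1 = j + 2 by ring, ← h0, zero_pow (by positivity)]
      have := hN 0
      have := hN (j + 1 + 2)
      positivity
    · refine le_of_mul_le_mul_right ?_ (pow_pos h0 (j + 1))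
      calc N (j + 1 + 1) ^ (j + 1 + 2) * N (j + 2) ^ (j + 1)
          = (N (j + 1 + 1) ^ 2) ^ (j + 2) := by
            rw [← pow_add, ← pow_mul]
            congr 1
            ring
        _ ≤ (A * (N (j + 1) * N (j + 1 + 2))) ^ (j + 2) := by gcongr
        _ = A ^ (j + 2) * N (j + 1) ^ (j + 2) * N (j + 1 + 2) ^ (j + 2) := by ring
        _ ≤ A ^ (j + 2) * (B * (N 0 * N (j + 2) ^ (j + 1))) * N (j + 1 + 2) ^ (j + 2) := by
          have := hN (j + 1 + 2)
          gcongr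
        _ = _ := by ring

theorem exists_pow_le_of_sq_le {A : ℝ} (hA : 0 < A) {k r : ℕ} (hk : 1 ≤ k) (hkr : k ≤ r) :
    ∃ B : ℝ, 0 < B ∧ ∀ N : ℕ → ℝ, (∀ i, 0 ≤ N i) →
      (∀ i, i + 2 ≤ r → N (i + 1) ^ 2 ≤ A * (N i * N (i + 2))) →
      N k ^ r ≤ B * (N 0 ^ (r - k) * N r ^ k) := by
  induction r, hkr using Nat.le_induction with
  | base => exact ⟨1, one_pos, fun N _ _ ↦ by simp⟩
  | succ r hkr ih =>
    obtain ⟨B, hB, ih⟩ := ih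
    obtain ⟨j, rfl⟩ : ∃ j, r = j + 1 := ⟨r - 1, by lia⟩
    obtain ⟨B', hB', h'⟩ := exists_pow_succ_le_of_sq_le hA j
    obtain ⟨d, hd⟩ : ∃ d, j + 1 = k + d := ⟨j + 1 - k, by lia⟩
    obtain ⟨D, hD, hDB⟩ : ∃ D : ℝ, 0 < D ∧ D ^ (j + 1) = B ^ (j + 2) * B' ^ k :=
      ⟨(B ^ (j + 2) * B' ^ k) ^ ((j + 1 : ℕ) : ℝ)⁻¹, by positivity,
        Real.rpow_inv_natCast_pow (by positivity) (by lia)⟩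
    refine ⟨D, hD, fun N hN h ↦ ?_⟩
    have h1 := ih N hN fun i hi ↦ h i (by lia)
    have h2 := h' N hN fun i hi ↦ h i (by lia)
    have e1 : j + 1 - k = d := by lia
    have e2 : j + 1 + 1 - k = d + 1 := by lia
    rw [e1] at h1
    rw [e2]
    have p0 := hN 0
    have p1 := hN (j + 1)
    have p2 := hN (j + 1 + 1)
    refine le_of_pow_le_pow_left₀ (n := j + 1) (by lia) (by positivity) ?_
    calc (N k ^ (j + 1 + 1)) ^ (j + 1) = (N k ^ (j + 1)) ^ (j + 2) := by
          rw [← pow_mul, ← pow_mul, mul_comm]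
      _ ≤ (B * (N 0 ^ d * N (j + 1) ^ k)) ^ (j + 2) := by
          have := hN k
          gcongr
      _ = B ^ (j + 2) * N 0 ^ (d * (j + 2)) * (N (j + 1) ^ (j + 2)) ^ k := by ring
      _ ≤ B ^ (j + 2) * N 0 ^ (d * (j + 2)) * (B' * (N 0 * N (j + 2) ^ (j + 1))) ^ k := by
          gcongr
      _ = B ^ (j + 2) * B' ^ k * (N 0 ^ (d * (j + 2) + k) * N (j + 2) ^ ((j + 1) * k)) := by ring
      _ = D ^ (j + 1) * (N 0 ^ ((d + 1) * (j + 1)) * N (j + 2) ^ ((j + 1) * k)) := by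
          rw [hDB, show d * (j + 2) + k = (d + 1) * (j + 1) by lia]
      _ = _ := by ring

theorem exists_L2_jap_rpow_mul_iteratedDeriv_le {μ : ℝ} (hμ : 0 ≤ μ) {k r : ℕ} (hk : 1 ≤ k)
    (hkr : k ≤ r) :
    ∃ C : ℝ, 0 < C ∧ ∀ f : SchwartzMap ℝ ℂ,
      L2 (fun x ↦ ((jap x ^ ((1 - (k : ℝ) / r) * μ) : ℝ) : ℂ) * iteratedDeriv k f x) ≤
        C * L2 (fun x ↦ ((jap x ^ μ : ℝ) : ℂ) * f x) ^ (1 - (k : ℝ) / r)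
          * L2 (iteratedDeriv r f) ^ ((k : ℝ) / r) := by
  have hr : (0 : ℝ) < r := by exact_mod_cast (by lia : 0 < r)
  have step (i : ℕ) : ∃ A : ℝ, 0 < A ∧ (i + 2 ≤ r → ∀ f : SchwartzMap ℝ ℂ,
      L2 (fun x ↦ ((jap x ^ ((1 - ((i + 1 : ℕ) : ℝ) / r) * μ) : ℝ) : ℂ)
          * iteratedDeriv (i + 1) f x) ^ 2 ≤
        A * (L2 (fun x ↦ ((jap x ^ ((1 - (i : ℝ) / r) * μ) : ℝ) : ℂ) * iteratedDeriv i f x)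
          * L2 (fun x ↦ ((jap x ^ ((1 - ((i + 2 : ℕ) : ℝ) / r) * μ) : ℝ) : ℂ)
            * iteratedDeriv (i + 2) f x))) := by
    by_cases hi : i + 2 ≤ r
    · have hi' : ((i + 1 : ℕ) : ℝ) / r ≤ 1 := by
        rw [div_le_one hr]
        exact_mod_cast (by lia : i + 1 ≤ r)
      obtain ⟨A, hA, H⟩ := L2_jap_rpow_mul_deriv_sq_le (a := (1 - ((i + 1 : ℕ) : ℝ) / r) * μ)
        (s := μ / r) (mul_nonneg (by linarith) hμ) (by positivity)
      refine ⟨A, hA, fun _ f ↦ ?_⟩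
      have := H _ _ _ (hasDerivAt_schwartzDeriv f i) (hasDerivAt_schwartzDeriv f (i + 1))
      simp only [coe_schwartzDeriv] at this
      convert! this using 8
      · push_cast; ring
      · push_cast; ring
    · exact ⟨1, one_pos, fun h ↦ absurd h hi⟩
  choose A hA hstep using step
  obtain ⟨B, hB, H⟩ := exists_pow_le_of_sq_le
    (A := ∑ i ∈ Finset.range (r + 1), A i) (Finset.sum_pos (fun i _ ↦ hA i) (by simp)) hk hkr
  refine ⟨B ^ (r : ℝ)⁻¹, by positivity, fun f ↦ ?_⟩
  have := H (fun i ↦ L2 (fun x ↦ ((jap x ^ ((1 - (i : ℝ) / r) * μ) : ℝ) : ℂ)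
    * iteratedDeriv i f x)) (fun i ↦ ENNReal.toReal_nonneg) fun i hi ↦ by
      refine (hstep i hi f).trans (mul_le_mul_of_nonneg_right ?_
        (mul_nonneg ENNReal.toReal_nonneg ENNReal.toReal_nonneg))
      exact Finset.single_le_sum (f := A) (fun i _ ↦ (hA i).le) (by simp; lia)
  have hrr : (r : ℝ) / r = 1 := div_self hr.ne'
  simp only [hrr, Nat.cast_zero, zero_div, sub_zero, one_mul, iteratedDeriv_zero, sub_self,
    zero_mul, Real.rpow_zero, Complex.ofReal_one] at this
  have h0 : 0 ≤ L2 (fun x ↦ ((jap x ^ μ : ℝ) : ℂ) * f x) := ENNReal.toReal_nonneg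
  have h2 : 0 ≤ L2 (iteratedDeriv r f) := ENNReal.toReal_nonneg
  have h1 : 0 ≤ L2 (fun x ↦ ((jap x ^ ((1 - (k : ℝ) / r) * μ) : ℝ) : ℂ) * iteratedDeriv k f x) :=
    ENNReal.toReal_nonneg
  refine le_of_pow_le_pow_left₀ (n := r) (by lia) (by positivity) (this.trans_eq ?_)
  rw [mul_pow, mul_pow, Real.rpow_inv_natCast_pow hB.le (by lia), ← Real.rpow_mul_natCast h0,
    ← Real.rpow_mul_natCast h2, sub_mul, div_mul_cancel₀ _ hr.ne', one_mul, ← Nat.cast_sub hkr,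
    Real.rpow_natCast, Real.rpow_natCast, mul_assoc]

/-- **Weighted interpolation inequality** (Lemma 2.2):
`‖⟨x⟩^{θμ} ∂_x^{(1-θ)r} f‖_{L²} ≤ C ‖⟨x⟩^μ f‖_{L²}^θ ‖∂_x^r f‖_{L²}^{1-θ} + L.O.T.`,
where the lower-order terms are bounded by
`C Σ ‖⟨x⟩^{β(μ-1)} ∂_x^{(1-β)(r-1)} f‖_{L²}`, the sum running over all `β ∈ [0,1]`
with `(1-β)(r-1) ∈ ℤ⁺`, i.e. over derivative orders `l = (1-β)(r-1) ∈ {1,…,r-1}`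
with `β = 1 - l/(r-1)`. -/
theorem weighted_interpolation (μ : ℝ) (hμ : 0 < μ) (r : ℕ) (hr : 1 ≤ r)
    (θ : ℝ) (hθ : θ ∈ Set.Icc (0:ℝ) 1) (k : ℕ) (hk : 1 ≤ k)
    (hkθ : (k : ℝ) = (1 - θ) * r) :
    ∃ C : ℝ, 0 < C ∧ ∀ f : SchwartzMap ℝ ℂ,
      L2 (fun x => ((jap x ^ (θ * μ) : ℝ) : ℂ) * iteratedDeriv k (f : ℝ → ℂ) x)
        ≤ C * (L2 (fun x => ((jap x ^ μ : ℝ) : ℂ) * (f : ℝ → ℂ) x)) ^ θ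
              * (L2 (iteratedDeriv r (f : ℝ → ℂ))) ^ (1 - θ)
          + C * ∑ l ∈ Finset.Icc 1 (r - 1),
              L2 (fun x =>
                ((jap x ^ ((1 - (l : ℝ) / ((r : ℝ) - 1)) * (μ - 1)) : ℝ) : ℂ)
                  * iteratedDeriv l (f : ℝ → ℂ) x) := by
  have hr0 : (0 : ℝ) < r := by exact_mod_cast hr
  have hkr : k ≤ r := by
    have : (k : ℝ) ≤ r := by nlinarith [hθ.1]
    exact_mod_cast this
  have hθk : (k : ℝ) / r = 1 - θ := by rw [hkθ, mul_div_cancel_right₀ _ hr0.ne']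
  obtain ⟨C, hC, H⟩ := exists_L2_jap_rpow_mul_iteratedDeriv_le hμ.le hk hkr
  refine ⟨C, hC, fun f ↦ ?_⟩
  have := H f
  rw [hθk, sub_sub_cancel] at this
  exact this.trans (le_add_of_nonneg_right
    (mul_nonneg hC.le (Finset.sum_nonneg fun l _ ↦ ENNReal.toReal_nonneg)))
end
end

section
/- Let j ∈ ℤ⁺ and β ∈ ℤ⁺. There exists a constant C > 0 such that for every t ∈ ℝ and every f with ⟨x⟩^β f ∈ L²(ℝ) and ∂_x^{2jβ} f ∈ L²(ℝ) (e.g. f Schwartz), ‖ ⟨x⟩^β U_j(t) f ‖_{L²} ≤ C ⟨t⟩^β ( ‖⟨x⟩^β f‖_{L²} + ‖∂_x^{2jβ} f‖_{L²} ). -/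
open MeasureTheory Filter Set
open scoped ENNReal NNReal FourierTransform

noncomputable section

open scoped SchwartzMap ContDiff

theorem jap_sq (x : ℝ) : jap x ^ 2 = 1 + x ^ 2 :=
  Real.sq_sqrt (by positivity)

theorem jap_pos (x : ℝ) : 0 < jap x :=
  Real.sqrt_pos.2 (by positivity)

theorem one_le_jap (x : ℝ) : 1 ≤ jap x :=
  Real.one_le_sqrt.2 (by nlinarith [sq_nonneg x])

theorem abs_le_jap (x : ℝ) : |x| ≤ jap x :=
  Real.abs_le_sqrt (by linarith)

theorem jap_pow_hasTemperateGrowth (n : ℕ) :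
    (fun x : ℝ => ((jap x ^ n : ℝ) : ℂ)).HasTemperateGrowth := by
  have h : jap.HasTemperateGrowth := by
    have h' : jap = fun x : ℝ => (1 + ‖x‖ ^ 2) ^ (1 / 2 : ℝ) := by
      ext x
      simp [jap, Real.sqrt_eq_rpow]
    exact h' ▸ Function.hasTemperateGrowth_one_add_norm_sq_rpow ℝ (1 / 2)
  exact Function.Complex.hasTemperateGrowth_ofReal.comp (h.pow n)

theorem one_add_sq_pow_hasTemperateGrowth (n : ℕ) :
    (fun x : ℝ => (1 + x ^ 2) ^ n).HasTemperateGrowth := by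
  fun_prop

theorem L2_sq_eq_integral {g : ℝ → ℂ} (hg : Continuous g) : L2 g ^ 2 = ∫ x, ‖g x‖ ^ 2 := by
  have h0 : 0 ≤ ∫ x, ‖g x‖ ^ 2 := integral_nonneg fun x => by positivity
  have h := lpNorm_eq_integral_norm_rpow_toReal (μ := volume) (p := 2) (f := g) (by simp) (by simp)
    hg.aestronglyMeasurable
  rw [L2, toReal_eLpNorm hg.aestronglyMeasurable, h]
  simp only [ENNReal.toReal_ofNat, Real.rpow_ofNat]
  rw [← Real.rpow_natCast, ← Real.rpow_mul h0]
  norm_num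

/-- The square of the `L²` norm with weight `(1 + x²)ⁿ`. -/
def weightedSq (n : ℕ) (h : ℝ → ℂ) : ℝ := ∫ x, ((1 + x ^ 2) ^ n * ‖h x‖) ^ 2

theorem weightedSq_nonneg (n : ℕ) (h : ℝ → ℂ) : 0 ≤ weightedSq n h :=
  integral_nonneg fun x => by positivity

theorem integrable_mul_norm_sq {q : ℝ → ℝ} (hq : q.HasTemperateGrowth) (h : 𝓢(ℝ, ℂ)) :
    Integrable fun x => (q x * ‖h x‖) ^ 2 := by
  have := ((SchwartzMap.smulLeftCLM ℂ q h).memLp 2).integrable_norm_pow (by norm_num)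
  simpa [hq, norm_smul, mul_pow] using this

theorem integrable_weightedSq (n : ℕ) (h : 𝓢(ℝ, ℂ)) :
    Integrable fun x => ((1 + x ^ 2) ^ n * ‖h x‖) ^ 2 :=
  integrable_mul_norm_sq (one_add_sq_pow_hasTemperateGrowth n) h

theorem weightedSq_interpolation_step (b j : ℕ) {ε : ℝ} (hε : 0 < ε) :
    ∃ C : ℝ, 0 ≤ C ∧ ∀ h : 𝓢(ℝ, ℂ), weightedSq (b + j) (deriv h) ≤
      ε * weightedSq b (deriv (deriv h)) + C * weightedSq (b + 2 * j) h := by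
  set c : ℝ := ((2 * (b + j) : ℕ) : ℝ) with hc
  refine ⟨c ^ 2 + 1 / ε, by positivity, fun h => ?_⟩
  set h₁ : 𝓢(ℝ, ℂ) := SchwartzMap.derivCLM ℝ ℂ h
  set h₂ : 𝓢(ℝ, ℂ) := SchwartzMap.derivCLM ℝ ℂ h₁
  have e₁ : deriv h = h₁ := rfl
  have e₂ : deriv h₁ = h₂ := rfl
  have hq := one_add_sq_pow_hasTemperateGrowth (2 * (b + j))
  set F : 𝓢(ℝ, ℂ) := SchwartzMap.smulLeftCLM ℂ (fun x : ℝ => (1 + x ^ 2) ^ (2 * (b + j))) h₁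
    with hF
  have hFx : (F : ℝ → ℂ) = fun x => ((1 + x ^ 2) ^ (2 * (b + j)) : ℝ) • h₁ x := by
    ext x
    rw [hF, SchwartzMap.smulLeftCLM_apply_apply hq]
  have hF' : ∀ x, ‖deriv F x‖ ≤
      c * (1 + x ^ 2) ^ (2 * (b + j)) * ‖h₁ x‖ + (1 + x ^ 2) ^ (2 * (b + j)) * ‖h₂ x‖ := by
    intro x
    have hp : HasDerivAt (fun x : ℝ => (1 + x ^ 2) ^ (2 * (b + j)))
        (c * (1 + x ^ 2) ^ (2 * (b + j) - 1) * (2 * x)) x := by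
      convert! ((hasDerivAt_pow 2 x).const_add 1).pow (2 * (b + j)) using 1
      simp [hc]
    have hd := hp.smul (h₁.hasDerivAt x)
    have hb : |c * (1 + x ^ 2) ^ (2 * (b + j) - 1) * (2 * x)| ≤
        c * (1 + x ^ 2) ^ (2 * (b + j)) := by
      rcases Nat.eq_zero_or_pos (2 * (b + j)) with h0 | h0
      · simp [hc, h0]
      · have hx : |2 * x| ≤ 1 + x ^ 2 := by
          rw [abs_le]; constructor <;> nlinarith [sq_nonneg (x + 1), sq_nonneg (x - 1)]
        have hs : (1 + x ^ 2) ^ (2 * (b + j)) =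
            (1 + x ^ 2) ^ (2 * (b + j) - 1) * (1 + x ^ 2) := by
          rw [← pow_succ, Nat.sub_add_cancel h0]
        rw [hs, abs_mul, abs_of_nonneg (by positivity), ← mul_assoc]
        gcongr
    rw [hFx]
    erw [hd.deriv]
    refine (norm_add_le _ _).trans ?_
    rw [norm_smul, norm_smul, Real.norm_eq_abs, Real.norm_eq_abs, e₂,
      abs_of_nonneg (by positivity : (0 : ℝ) ≤ (1 + x ^ 2) ^ (2 * (b + j))), add_comm]
    gcongr
  have key := SchwartzMap.integral_bilinear_deriv_right_eq_neg_left F h (innerSL ℝ (E := ℂ))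
  have hl : ∫ x, innerSL ℝ (F x) (deriv h x) = weightedSq (b + j) h₁ := by
    refine integral_congr_ae (Eventually.of_forall fun x => ?_)
    simp only [innerSL_apply_apply, hFx, e₁]
    rw [real_inner_smul_left, real_inner_self_eq_norm_sq]
    ring
  have i₀ := integrable_weightedSq (b + 2 * j) h
  have i₁ := integrable_weightedSq (b + j) h₁
  have i₂ := integrable_weightedSq b h₂
  have i₁₂ : Integrable fun x : ℝ => 1 / 2 * ((1 + x ^ 2) ^ (b + j) * ‖h₁ x‖) ^ 2 +
      ε / 2 * ((1 + x ^ 2) ^ b * ‖h₂ x‖) ^ 2 := (i₁.const_mul _).add (i₂.const_mul _)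
  have hr : -∫ x, innerSL ℝ (deriv F x) (h x) ≤
      ∫ x, (1 / 2 * ((1 + x ^ 2) ^ (b + j) * ‖h₁ x‖) ^ 2 +
        ε / 2 * ((1 + x ^ 2) ^ b * ‖h₂ x‖) ^ 2 +
        (c ^ 2 + 1 / ε) / 2 * ((1 + x ^ 2) ^ (b + 2 * j) * ‖h x‖) ^ 2) := by
    rw [← integral_neg]
    refine integral_mono
      (SchwartzMap.pairing (innerSL ℝ) (SchwartzMap.derivCLM ℝ ℂ F) h).integrable.neg
      (i₁₂.add (i₀.const_mul _)) fun x => ?_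
    simp only [innerSL_apply_apply]
    have h1 := (neg_le_abs _).trans (abs_real_inner_le_norm (deriv F x) (h x))
    have h2 := mul_le_mul_of_nonneg_right (hF' x) (norm_nonneg (h x))
    refine h1.trans (h2.trans ?_)
    set p : ℝ := 1 + x ^ 2
    have hp : 1 ≤ p := by simp only [p]; nlinarith [sq_nonneg x]
    have hle : p ^ (2 * (b + j)) ≤ p ^ (b + j) * p ^ (b + 2 * j) := by
      rw [← pow_add]; exact pow_le_pow_right₀ hp (by omega)
    have heq : p ^ (2 * (b + j)) = p ^ b * p ^ (b + 2 * j) := by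
      rw [← pow_add]; congr 1; omega
    have hc0 : 0 ≤ c := by positivity
    have A : c * p ^ (2 * (b + j)) * ‖h₁ x‖ * ‖h x‖ ≤
        c * (p ^ (b + j) * ‖h₁ x‖) * (p ^ (b + 2 * j) * ‖h x‖) := by
      calc c * p ^ (2 * (b + j)) * ‖h₁ x‖ * ‖h x‖
          ≤ c * (p ^ (b + j) * p ^ (b + 2 * j)) * ‖h₁ x‖ * ‖h x‖ := by gcongr
        _ = _ := by ring
    have B : p ^ (2 * (b + j)) * ‖h₂ x‖ * ‖h x‖ =
        (p ^ b * ‖h₂ x‖) * (p ^ (b + 2 * j) * ‖h x‖) := by rw [heq]; ring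
    rw [add_mul, B]
    generalize p ^ (b + j) * ‖h₁ x‖ = X at *
    generalize p ^ (b + 2 * j) * ‖h x‖ = Y at *
    generalize p ^ b * ‖h₂ x‖ = Z at *
    have D : Z * Y ≤ ε / 2 * Z ^ 2 + 1 / ε / 2 * Y ^ 2 := by
      have : ε / 2 * Z ^ 2 + 1 / ε / 2 * Y ^ 2 - Z * Y = (ε * Z - Y) ^ 2 / (2 * ε) := by
        field_simp; ring
      have : 0 ≤ (ε * Z - Y) ^ 2 / (2 * ε) := by positivity
      linarith
    nlinarith [sq_nonneg (X - c * Y)]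
  rw [integral_add i₁₂ (i₀.const_mul _),
    integral_add (i₁.const_mul _) (i₂.const_mul _), integral_const_mul, integral_const_mul,
    integral_const_mul, ← key, hl] at hr
  change _ ≤ 1 / 2 * weightedSq (b + j) h₁ + ε / 2 * weightedSq b h₂ +
    (c ^ 2 + 1 / ε) / 2 * weightedSq (b + 2 * j) h at hr
  rw [e₁, e₂]
  linarith

/-- A family of nonnegative sequences in which each term is controlled by its neighbours, with an
arbitrarily small constant in front of the next one, is controlled by its end points. -/
theorem le_endpoints_of_interpolation_step {ι : Type*} {M : ι → ℕ → ℝ} {N : ℕ}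
    (hM : ∀ g k, 0 ≤ M g k)
    (step : ∀ k, k + 2 ≤ N → ∀ ε : ℝ, 0 < ε → ∃ C : ℝ, 0 ≤ C ∧ ∀ g,
      M g (k + 1) ≤ ε * M g (k + 2) + C * M g k) :
    ∃ C : ℝ, 0 ≤ C ∧ ∀ k ≤ N, ∀ g, M g k ≤ C * (M g 0 + M g N) := by
  have up : ∀ k, k + 1 ≤ N → ∀ ε : ℝ, 0 < ε → ∃ C : ℝ, 0 ≤ C ∧ ∀ g,
      M g k ≤ ε * M g (k + 1) + C * M g 0 := by
    intro k
    induction k with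
    | zero =>
      intro _ ε hε
      exact ⟨1, zero_le_one, fun g => by nlinarith [hM g 1]⟩
    | succ k ih =>
      intro hk ε hε
      obtain ⟨C, hC, h⟩ := step k hk (ε / 2) (by positivity)
      obtain ⟨B, hB, h'⟩ := ih (by omega) (1 / (2 * (C + 1))) (by positivity)
      refine ⟨2 * (C * B), by positivity, fun g => ?_⟩
      have h1 := mul_le_mul_of_nonneg_left (h' g) hC
      have h2 : C * (1 / (2 * (C + 1))) ≤ 1 / 2 := by
        rw [mul_one_div, div_le_div_iff₀ (by positivity) (by positivity)]; linarith
      nlinarith [h g, mul_le_mul_of_nonneg_right h2 (hM g (k + 1))]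
  have down : ∀ d ≤ N, ∃ C : ℝ, 0 ≤ C ∧ ∀ g, M g (N - d) ≤ C * (M g 0 + M g N) := by
    intro d
    induction d with
    | zero => exact fun _ => ⟨1, zero_le_one, fun g => by simpa using hM g 0⟩
    | succ d ih =>
      intro hd
      obtain ⟨C, hC, h⟩ := ih (by omega)
      obtain ⟨B, hB, h'⟩ := up (N - (d + 1)) (by omega) 1 one_pos
      refine ⟨C + B, by positivity, fun g => ?_⟩
      have h1 := h' g
      rw [show N - (d + 1) + 1 = N - d by omega] at h1
      nlinarith [h g, mul_nonneg hB (hM g N)]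
  choose! C hC h using down
  refine ⟨∑ d ∈ Finset.range (N + 1), C d,
    Finset.sum_nonneg fun d hd => hC d (by simpa [Nat.lt_succ_iff] using hd), fun k hk g => ?_⟩
  have h1 := h (N - k) (Nat.sub_le _ _) g
  rw [Nat.sub_sub_self hk] at h1
  refine h1.trans (mul_le_mul_of_nonneg_right ?_ (add_nonneg (hM g 0) (hM g N)))
  exact Finset.single_le_sum (f := C) (fun d hd => hC d (by simpa [Nat.lt_succ_iff] using hd))
    (by simp)

theorem SchwartzMap.coe_derivCLM_iterate (g : 𝓢(ℝ, ℂ)) (k : ℕ) :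
    (((SchwartzMap.derivCLM ℝ ℂ)^[k] g : 𝓢(ℝ, ℂ)) : ℝ → ℂ) = iteratedDeriv k g := by
  induction k with
  | zero => simp
  | succ k ih =>
    rw [Function.iterate_succ_apply', iteratedDeriv_succ, ← ih]
    rfl

theorem weightedSq_iteratedDeriv_le (j N : ℕ) :
    ∃ C : ℝ, 0 ≤ C ∧ ∀ k ≤ N, ∀ g : 𝓢(ℝ, ℂ), weightedSq (j * (N - k)) (iteratedDeriv k g) ≤
      C * (weightedSq (j * N) g + weightedSq 0 (iteratedDeriv N g)) := by
  obtain ⟨C, hC, h⟩ := le_endpoints_of_interpolation_step (N := N)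
    (M := fun (g : 𝓢(ℝ, ℂ)) k => weightedSq (j * (N - k)) (iteratedDeriv k g))
    (fun g k => weightedSq_nonneg _ _) fun k hk ε hε => by
      obtain ⟨C, hC, h⟩ := weightedSq_interpolation_step (j * (N - (k + 2))) j hε
      refine ⟨C, hC, fun g => ?_⟩
      have h1 := h ((SchwartzMap.derivCLM ℝ ℂ)^[k] g)
      rw [SchwartzMap.coe_derivCLM_iterate, ← iteratedDeriv_succ, ← iteratedDeriv_succ] at h1
      obtain ⟨m, rfl⟩ := Nat.exists_eq_add_of_le hk
      convert h1 using 3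
      all_goals congr 1
      · rw [show k + 2 + m - (k + 1) = m + 1 by omega, show k + 2 + m - (k + 2) = m by omega]; ring
      · rw [show k + 2 + m - k = m + 2 by omega, show k + 2 + m - (k + 2) = m by omega]; ring
  refine ⟨C, hC, fun k hk g => ?_⟩
  simpa using h k hk g

theorem iteratedDeriv_cexp_I_mul_ofReal (n : ℕ) :
    iteratedDeriv n (fun y : ℝ => Complex.exp (Complex.I * y)) =
      fun y : ℝ => Complex.I ^ n * Complex.exp (Complex.I * y) := by
  induction n with
  | zero => simp
  | succ n ih =>
    rw [iteratedDeriv_succ, ih]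
    ext y
    have h : HasDerivAt (fun y : ℝ => Complex.I * (y : ℂ)) Complex.I y := by
      simpa using (Complex.ofRealCLM.hasDerivAt (x := y)).const_mul Complex.I
    rw [(h.cexp.const_mul (Complex.I ^ n)).deriv]
    ring

theorem norm_iteratedFDeriv_cexp_I_mul_ofReal (n : ℕ) (y : ℝ) :
    ‖iteratedFDeriv ℝ n (fun y : ℝ => Complex.exp (Complex.I * y)) y‖ = 1 := by
  rw [norm_iteratedFDeriv_eq_norm_iteratedDeriv, iteratedDeriv_cexp_I_mul_ofReal]
  simp [mul_comm Complex.I, Complex.norm_exp_ofReal_mul_I]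

theorem contDiff_cexp_I_mul_ofReal :
    ContDiff ℝ ∞ fun y : ℝ => Complex.exp (Complex.I * y) :=
  (contDiff_const.mul Complex.ofRealCLM.contDiff).cexp

theorem cexp_I_mul_ofReal_hasTemperateGrowth :
    (fun y : ℝ => Complex.exp (Complex.I * y)).HasTemperateGrowth :=
  ⟨contDiff_cexp_I_mul_ofReal, fun n => ⟨0, 1, fun y => by
    simp [norm_iteratedFDeriv_cexp_I_mul_ofReal]⟩⟩

/-- The Fourier multiplier of `U_j(t)`. -/
def groupSymbol (j : ℕ) (t : ℝ) (ξ : ℝ) : ℂ :=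
  Complex.exp (-(t : ℂ) * (Complex.I * ξ) ^ (2 * j + 1))

theorem groupSymbol_eq_comp (j : ℕ) (t : ℝ) :
    groupSymbol j t = (fun y : ℝ => Complex.exp (Complex.I * y)) ∘
      fun ξ : ℝ => (-t * (-1) ^ j) * ξ ^ (2 * j + 1) := by
  ext ξ
  simp only [groupSymbol, Function.comp_apply]
  congr 1
  push_cast
  rw [mul_pow, pow_succ Complex.I, pow_mul, Complex.I_sq]
  ring

theorem groupSymbol_hasTemperateGrowth (j : ℕ) (t : ℝ) :
    (groupSymbol j t).HasTemperateGrowth := by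
  rw [groupSymbol_eq_comp]
  exact cexp_I_mul_ofReal_hasTemperateGrowth.comp (by fun_prop)

theorem norm_groupSymbol (j : ℕ) (t ξ : ℝ) : ‖groupSymbol j t ξ‖ = 1 := by
  rw [groupSymbol_eq_comp, Function.comp_apply, mul_comm, Complex.norm_exp_ofReal_mul_I]

theorem norm_iteratedFDeriv_groupSymbol_le (j n : ℕ) (t ξ : ℝ) :
    ‖iteratedFDeriv ℝ n (groupSymbol j t) ξ‖ ≤
      n.factorial * ((2 * j + 1).factorial * jap t * (1 + ξ ^ 2) ^ j) ^ n := by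
  have hw : 1 ≤ (1 + ξ ^ 2) ^ j := one_le_pow₀ (by nlinarith [sq_nonneg ξ])
  have hfac : (1 : ℝ) ≤ (2 * j + 1).factorial := mod_cast Nat.one_le_iff_ne_zero.2
    (Nat.factorial_ne_zero _)
  have hD : 1 ≤ (2 * j + 1).factorial * jap t * (1 + ξ ^ 2) ^ j :=
    one_le_mul_of_one_le_of_one_le (one_le_mul_of_one_le_of_one_le hfac (one_le_jap t)) hw
  rw [groupSymbol_eq_comp]
  refine (norm_iteratedFDeriv_comp_le (n := n) (C := 1)
    (D := (2 * j + 1).factorial * jap t * (1 + ξ ^ 2) ^ j) contDiff_cexp_I_mul_ofReal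
    (by fun_prop) (mod_cast le_top) ξ (fun i _ => (norm_iteratedFDeriv_cexp_I_mul_ofReal i _).le)
    fun i hi _ => ?_).trans_eq (by rw [mul_one])
  rw [norm_iteratedFDeriv_eq_norm_iteratedDeriv, iteratedDeriv_const_mul_field,
    iteratedDeriv_pow]
  refine le_trans ?_ (le_self_pow₀ hD (by omega))
  have ht : |-t * (-1) ^ j| ≤ jap t := by
    simpa [abs_mul, abs_pow] using abs_le_jap t
  have hdesc : (((2 * j + 1).descFactorial i : ℕ) : ℝ) ≤ (2 * j + 1).factorial := by
    rcases le_or_gt i (2 * j + 1) with h | h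
    · rw [Nat.descFactorial_eq_div h]
      exact mod_cast Nat.div_le_self _ _
    · rw [Nat.descFactorial_of_lt h, Nat.cast_zero]
      positivity
  have hpow : |ξ| ^ (2 * j + 1 - i) ≤ (1 + ξ ^ 2) ^ j := by
    rw [← jap_sq, ← pow_mul]
    exact (pow_le_pow_left₀ (abs_nonneg _) (abs_le_jap ξ) _).trans
      (pow_le_pow_right₀ (one_le_jap ξ) (by omega))
  rw [norm_mul, norm_mul (_ : ℝ) (ξ ^ _), norm_pow ξ, Real.norm_eq_abs,
    Real.norm_eq_abs, Real.norm_eq_abs, Nat.abs_cast]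
  calc |-t * (-1) ^ j| * (((2 * j + 1).descFactorial i : ℕ) * |ξ| ^ (2 * j + 1 - i))
      ≤ jap t * ((2 * j + 1).factorial * (1 + ξ ^ 2) ^ j) := by
        have := jap_pos t
        gcongr
    _ = _ := by ring

theorem norm_iteratedDeriv_groupSymbol_mul_sq_le (j n : ℕ) :
    ∃ C : ℝ, 0 ≤ C ∧ ∀ (t ξ : ℝ) (g : 𝓢(ℝ, ℂ)),
      ‖iteratedDeriv n (fun ξ => groupSymbol j t ξ * g ξ) ξ‖ ^ 2 ≤ C * (jap t ^ n) ^ 2 *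
        ∑ k ∈ Finset.range (n + 1), ((1 + ξ ^ 2) ^ (j * (n - k)) * ‖iteratedDeriv k g ξ‖) ^ 2 := by
  set c : ℕ → ℝ := fun k =>
    n.choose k * (n - k).factorial * ((2 * j + 1).factorial : ℝ) ^ (n - k) with hc
  refine ⟨∑ k ∈ Finset.range (n + 1), c k ^ 2, by positivity, fun t ξ g => ?_⟩
  have h := norm_iteratedFDeriv_mul_le (𝕜 := ℝ) (N := ∞) (g.smooth ⊤)
    (groupSymbol_hasTemperateGrowth j t).1 ξ (n := n) (mod_cast le_top)
  simp_rw [norm_iteratedFDeriv_eq_norm_iteratedDeriv (𝕜 := ℝ) (f := (g : ℝ → ℂ))] at h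
  rw [norm_iteratedFDeriv_eq_norm_iteratedDeriv] at h
  simp_rw [mul_comm (g _) (groupSymbol j t _)] at h
  set X : ℕ → ℝ := fun k => (1 + ξ ^ 2) ^ (j * (n - k)) * ‖iteratedDeriv k g ξ‖ with hX
  have hX0 : ∀ k, 0 ≤ X k := fun k => by positivity
  have ht := jap_pos t
  have hterm : ∀ k ∈ Finset.range (n + 1),
      (n.choose k : ℝ) * ‖iteratedDeriv k g ξ‖ * ‖iteratedFDeriv ℝ (n - k) (groupSymbol j t) ξ‖ ≤
        jap t ^ n * (c k * X k) := by
    intro k hk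
    have h1 := norm_iteratedFDeriv_groupSymbol_le j (n - k) t ξ
    have h2 : jap t ^ (n - k) ≤ jap t ^ n := pow_le_pow_right₀ (one_le_jap t) (Nat.sub_le _ _)
    calc _ ≤ (n.choose k : ℝ) * ‖iteratedDeriv k g ξ‖ *
          ((n - k).factorial * ((2 * j + 1).factorial * jap t * (1 + ξ ^ 2) ^ j) ^ (n - k)) := by
          gcongr
      _ = jap t ^ (n - k) * (c k * X k) := by
          simp only [hc, hX, mul_pow, pow_mul]
          ring
      _ ≤ _ := by
          have : 0 ≤ c k * X k := by positivity
          gcongr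
  have h3 := h.trans (Finset.sum_le_sum hterm)
  rw [← Finset.mul_sum] at h3
  calc _ ≤ (jap t ^ n * ∑ k ∈ Finset.range (n + 1), c k * X k) ^ 2 := by gcongr
    _ = (jap t ^ n) ^ 2 * (∑ k ∈ Finset.range (n + 1), c k * X k) ^ 2 := by ring
    _ ≤ (jap t ^ n) ^ 2 *
        ((∑ k ∈ Finset.range (n + 1), c k ^ 2) * ∑ k ∈ Finset.range (n + 1), X k ^ 2) := by
        gcongr
        exact Finset.sum_mul_sq_le_sq_mul_sq _ _ _
    _ = _ := by ring

theorem integral_norm_sq_iteratedDeriv_groupSymbol_mul_le (j n : ℕ) :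
    ∃ C : ℝ, 0 ≤ C ∧ ∀ (t : ℝ) (g : 𝓢(ℝ, ℂ)),
      ∫ ξ, ‖iteratedDeriv n (fun ξ => groupSymbol j t ξ * g ξ) ξ‖ ^ 2 ≤ C * (jap t ^ n) ^ 2 *
        (weightedSq (j * n) g + weightedSq 0 (iteratedDeriv n g)) := by
  obtain ⟨C, hC, h⟩ := norm_iteratedDeriv_groupSymbol_mul_sq_le j n
  obtain ⟨B, hB, h'⟩ := weightedSq_iteratedDeriv_le j n
  refine ⟨C * ((n + 1) * B), by positivity, fun t g => ?_⟩
  have hint : ∀ k ∈ Finset.range (n + 1), Integrable fun ξ : ℝ =>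
      ((1 + ξ ^ 2) ^ (j * (n - k)) * ‖iteratedDeriv k g ξ‖) ^ 2 := fun k _ => by
    simpa only [SchwartzMap.coe_derivCLM_iterate] using
      integrable_weightedSq (j * (n - k)) ((SchwartzMap.derivCLM ℝ ℂ)^[k] g)
  have h1 := integral_mono_of_nonneg (μ := volume)
    (Eventually.of_forall fun ξ => by positivity)
    ((integrable_finsetSum _ hint).const_mul (C * (jap t ^ n) ^ 2))
    (Eventually.of_forall fun ξ => h t ξ g)
  rw [integral_const_mul, integral_finsetSum _ hint] at h1
  refine h1.trans ?_
  have h2 : ∑ k ∈ Finset.range (n + 1), weightedSq (j * (n - k)) (iteratedDeriv k g) ≤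
      ∑ k ∈ Finset.range (n + 1),
        B * (weightedSq (j * n) g + weightedSq 0 (iteratedDeriv n g)) :=
    Finset.sum_le_sum fun k hk => h' k (by simpa [Nat.lt_succ_iff] using hk) g
  rw [Finset.sum_const, Finset.card_range, nsmul_eq_mul] at h2
  push_cast at h2
  calc _ ≤ C * (jap t ^ n) ^ 2 * ((n + 1) *
        (B * (weightedSq (j * n) g + weightedSq 0 (iteratedDeriv n g)))) :=
        mul_le_mul_of_nonneg_left h2 (by positivity)
    _ = _ := by ring

theorem integral_norm_sq_iteratedDeriv_fourier (n : ℕ) (h : 𝓢(ℝ, ℂ)) :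
    ∫ ξ, ‖iteratedDeriv n (𝓕 (h : ℝ → ℂ)) ξ‖ ^ 2 =
      ((2 * Real.pi) ^ n) ^ 2 * ∫ x, (|x| ^ n * ‖h x‖) ^ 2 := by
  have hq : (fun x : ℝ => (-2 * Real.pi * Complex.I * x) ^ n).HasTemperateGrowth := by fun_prop
  set k : 𝓢(ℝ, ℂ) :=
    SchwartzMap.smulLeftCLM ℂ (fun x : ℝ => (-2 * Real.pi * Complex.I * x) ^ n) h with hk
  have hkx : (fun x : ℝ => (-2 * Real.pi * Complex.I * x) ^ n • h x) = k :=
    (SchwartzMap.smulLeftCLM_apply hq h).symm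
  have hint : ∀ m : ℕ, (m : ℕ∞) ≤ ⊤ → Integrable fun x : ℝ => x ^ m • h x := fun m _ => by
    have hm : (fun x : ℝ => x ^ m).HasTemperateGrowth := by fun_prop
    simpa only [SchwartzMap.smulLeftCLM_apply hm] using
      (SchwartzMap.smulLeftCLM ℂ (fun x : ℝ => x ^ m) h).integrable (μ := volume)
  rw [Real.iteratedDeriv_fourier hint le_top, hkx, ← SchwartzMap.fourier_coe,
    SchwartzMap.integral_norm_sq_fourier, ← hkx, ← integral_const_mul]
  refine integral_congr_ae (Eventually.of_forall fun x => ?_)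
  simp [abs_of_pos Real.pi_pos, mul_pow]
  ring

theorem integral_norm_sq_iteratedDeriv (n : ℕ) (f : 𝓢(ℝ, ℂ)) :
    ∫ x, ‖iteratedDeriv n f x‖ ^ 2 =
      ((2 * Real.pi) ^ n) ^ 2 * ∫ ξ, (|ξ| ^ n * ‖(𝓕 f : 𝓢(ℝ, ℂ)) ξ‖) ^ 2 := by
  have h := Real.fourier_iteratedDeriv (N := ⊤) (n := n) (f.smooth ⊤) (fun m _ => by
    rw [← SchwartzMap.coe_derivCLM_iterate]; exact SchwartzMap.integrable _) le_top
  rw [← SchwartzMap.coe_derivCLM_iterate, ← SchwartzMap.integral_norm_sq_fourier,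
    SchwartzMap.fourier_coe, SchwartzMap.coe_derivCLM_iterate, h, ← integral_const_mul]
  refine integral_congr_ae (Eventually.of_forall fun x => ?_)
  simp [abs_of_pos Real.pi_pos, mul_pow, SchwartzMap.fourier_coe]
  ring

theorem integrable_abs_pow_mul_norm_sq (n : ℕ) (h : 𝓢(ℝ, ℂ)) :
    Integrable fun x : ℝ => (|x| ^ n * ‖h x‖) ^ 2 := by
  have hq : (fun x : ℝ => x ^ n).HasTemperateGrowth := by fun_prop
  refine (integrable_mul_norm_sq hq h).congr (Eventually.of_forall fun x => ?_)
  dsimp only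
  rw [mul_pow, mul_pow, ← abs_pow, sq_abs]

theorem integral_jap_pow_mul_norm_sq_le (n : ℕ) (h : 𝓢(ℝ, ℂ)) :
    ∫ x, (jap x ^ n * ‖h x‖) ^ 2 ≤
      2 ^ n * ((∫ x, ‖h x‖ ^ 2) + ∫ x, (|x| ^ n * ‖h x‖) ^ 2) := by
  have i₀ : Integrable fun x => ‖h x‖ ^ 2 := by
    simpa using integrable_abs_pow_mul_norm_sq 0 h
  have i₁ := integrable_abs_pow_mul_norm_sq n h
  rw [← integral_add i₀ i₁, ← integral_const_mul]
  refine integral_mono_of_nonneg (Eventually.of_forall fun x => by positivity)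
    ((i₀.add i₁).const_mul _) (Eventually.of_forall fun x => ?_)
  have h1 : (1 + x ^ 2) ^ n ≤ 2 ^ n * (1 + (x ^ 2) ^ n) := by
    refine (add_pow_le zero_le_one (sq_nonneg x) n).trans ?_
    rw [one_pow]
    gcongr <;> simp
  have h2 : (jap x ^ n * ‖h x‖) ^ 2 = (1 + x ^ 2) ^ n * ‖h x‖ ^ 2 := by
    rw [← jap_sq, mul_pow]; ring
  have h3 : (|x| ^ n * ‖h x‖) ^ 2 = (x ^ 2) ^ n * ‖h x‖ ^ 2 := by
    rw [← sq_abs x, mul_pow]; ring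
  simp only [h2, h3]
  calc _ ≤ 2 ^ n * (1 + (x ^ 2) ^ n) * ‖h x‖ ^ 2 := by gcongr
    _ = _ := by ring

theorem integral_abs_pow_mul_norm_sq_le {m n : ℕ} (hmn : m ≤ n) (h : 𝓢(ℝ, ℂ)) :
    ∫ x, (|x| ^ m * ‖h x‖) ^ 2 ≤ ∫ x, (jap x ^ n * ‖h x‖) ^ 2 := by
  have hi : Integrable fun x => (jap x ^ n * ‖h x‖) ^ 2 := by
    have hq := jap_pow_hasTemperateGrowth n
    have := ((SchwartzMap.smulLeftCLM ℂ (fun x : ℝ => ((jap x ^ n : ℝ) : ℂ)) h).memLp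
      2).integrable_norm_pow (by norm_num)
    simp only [SchwartzMap.smulLeftCLM_apply_apply hq, norm_smul, Complex.norm_real,
      Real.norm_eq_abs] at this
    simpa [abs_of_pos (jap_pos _)] using this
  refine integral_mono_of_nonneg (Eventually.of_forall fun x => by positivity) hi
    (Eventually.of_forall fun x => ?_)
  have h1 : |x| ^ m ≤ jap x ^ n :=
    (pow_le_pow_left₀ (abs_nonneg x) (abs_le_jap x) m).trans (pow_le_pow_right₀ (one_le_jap x) hmn)
  dsimp only
  gcongr

theorem L2_jap_pow_mul_sq (n : ℕ) (h : 𝓢(ℝ, ℂ)) :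
    L2 (fun x => ((jap x ^ n : ℝ) : ℂ) * h x) ^ 2 = ∫ x, (jap x ^ n * ‖h x‖) ^ 2 := by
  have hc : Continuous fun x => ((jap x ^ n : ℝ) : ℂ) * h x :=
    (jap_pow_hasTemperateGrowth n).1.continuous.mul h.continuous
  rw [L2_sq_eq_integral hc]
  simp [abs_of_pos (jap_pos _)]

/-- `U_j(t) f` as a Schwartz function. -/
def groupSchwartz (j : ℕ) (t : ℝ) (f : 𝓢(ℝ, ℂ)) : 𝓢(ℝ, ℂ) :=
  𝓕⁻ (SchwartzMap.smulLeftCLM ℂ (groupSymbol j t) (𝓕 f))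

theorem coe_groupSchwartz (j : ℕ) (t : ℝ) (f : 𝓢(ℝ, ℂ)) :
    (groupSchwartz j t f : ℝ → ℂ) = Uop j t f := by
  rw [groupSchwartz, SchwartzMap.fourierInv_coe,
    SchwartzMap.smulLeftCLM_apply (groupSymbol_hasTemperateGrowth j t)]
  rfl

theorem coe_fourier_groupSchwartz (j : ℕ) (t : ℝ) (f : 𝓢(ℝ, ℂ)) :
    ((𝓕 (groupSchwartz j t f) : 𝓢(ℝ, ℂ)) : ℝ → ℂ) =
      fun ξ => groupSymbol j t ξ * (𝓕 f : 𝓢(ℝ, ℂ)) ξ := by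
  rw [groupSchwartz, FourierTransform.fourier_fourierInv_eq,
    SchwartzMap.smulLeftCLM_apply (groupSymbol_hasTemperateGrowth j t)]
  rfl

theorem integral_norm_sq_groupSchwartz (j : ℕ) (t : ℝ) (f : 𝓢(ℝ, ℂ)) :
    ∫ x, ‖groupSchwartz j t f x‖ ^ 2 = ∫ x, ‖f x‖ ^ 2 := by
  rw [← SchwartzMap.integral_norm_sq_fourier, coe_fourier_groupSchwartz,
    ← SchwartzMap.integral_norm_sq_fourier f]
  simp [norm_groupSymbol]

theorem weightedSq_fourier_le (n : ℕ) (f : 𝓢(ℝ, ℂ)) :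
    weightedSq n (𝓕 f : 𝓢(ℝ, ℂ)) ≤
      2 ^ (2 * n) * ((∫ x, ‖f x‖ ^ 2) + ∫ x, ‖iteratedDeriv (2 * n) f x‖ ^ 2) := by
  have h1 := integral_jap_pow_mul_norm_sq_le (2 * n) (𝓕 f : 𝓢(ℝ, ℂ))
  rw [SchwartzMap.integral_norm_sq_fourier] at h1
  simp only [pow_mul, jap_sq] at h1
  have h2 : ∫ ξ, (|ξ| ^ (2 * n) * ‖(𝓕 f : 𝓢(ℝ, ℂ)) ξ‖) ^ 2 ≤
      ∫ x, ‖iteratedDeriv (2 * n) f x‖ ^ 2 := by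
    rw [integral_norm_sq_iteratedDeriv]
    exact le_mul_of_one_le_left (integral_nonneg fun x => by positivity)
      (one_le_pow₀ (one_le_pow₀ (by nlinarith [Real.pi_gt_three])))
  simp only [pow_mul] at h2 ⊢
  exact h1.trans (by gcongr)

/-- **Weighted bound for the group** (Lemma 2.3):
`‖⟨x⟩^β U_j(t) f‖_{L²} ≤ C ⟨t⟩^β (‖⟨x⟩^β f‖_{L²} + ‖∂_x^{2jβ} f‖_{L²})`. -/
theorem weighted_group_bound (j β : ℕ) (hj : 1 ≤ j) (hβ : 1 ≤ β) :
    ∃ C : ℝ, 0 < C ∧ ∀ t : ℝ, ∀ f : SchwartzMap ℝ ℂ,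
      L2 (fun x => ((jap x ^ β : ℝ) : ℂ) * Uop j t (f : ℝ → ℂ) x)
        ≤ C * jap t ^ β *
          (L2 (fun x => ((jap x ^ β : ℝ) : ℂ) * (f : ℝ → ℂ) x)
            + L2 (iteratedDeriv (2 * j * β) (f : ℝ → ℂ))) := by
  obtain ⟨B, hB, hBd⟩ := integral_norm_sq_iteratedDeriv_groupSymbol_mul_le j β
  set P : ℝ := ((2 * Real.pi) ^ β) ^ 2
  have hP : 1 ≤ P := one_le_pow₀ (one_le_pow₀ (by nlinarith [Real.pi_gt_three]))
  set K : ℝ := 2 ^ β * (1 + B * (2 ^ (2 * (j * β)) + P)) with hK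
  have hK0 : 0 < K := by positivity
  refine ⟨Real.sqrt K, Real.sqrt_pos.2 hK0, fun t f => ?_⟩
  have hT : 1 ≤ jap t ^ β := one_le_pow₀ (one_le_jap t)
  rw [← coe_groupSchwartz]
  set u := groupSchwartz j t f with hu
  have hR : 0 ≤ L2 (iteratedDeriv (2 * j * β) f) := ENNReal.toReal_nonneg
  have hA : 0 ≤ L2 (fun x => ((jap x ^ β : ℝ) : ℂ) * f x) := ENNReal.toReal_nonneg
  have hsq : L2 (fun x => ((jap x ^ β : ℝ) : ℂ) * u x) ^ 2 ≤ K * (jap t ^ β) ^ 2 *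
      (L2 (fun x => ((jap x ^ β : ℝ) : ℂ) * f x) ^ 2 + L2 (iteratedDeriv (2 * j * β) f) ^ 2) := by
    rw [L2_jap_pow_mul_sq, L2_jap_pow_mul_sq,
      L2_sq_eq_integral ((f.smooth (2 * j * β : ℕ)).continuous_iteratedDeriv _ le_rfl)]
    have h1 := integral_jap_pow_mul_norm_sq_le β u
    rw [hu, integral_norm_sq_groupSchwartz, ← hu] at h1
    have h2 := integral_norm_sq_iteratedDeriv_fourier β u
    rw [← SchwartzMap.fourier_coe, hu, coe_fourier_groupSchwartz, ← hu] at h2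
    have h3 := hBd t (𝓕 f)
    have h4 := weightedSq_fourier_le (j * β) f
    have h5 : weightedSq 0 (iteratedDeriv β (𝓕 f : 𝓢(ℝ, ℂ))) =
        P * ∫ x, (|x| ^ β * ‖f x‖) ^ 2 := by
      rw [← integral_norm_sq_iteratedDeriv_fourier β f]
      simp [weightedSq, SchwartzMap.fourier_coe]
    have h6 := integral_abs_pow_mul_norm_sq_le (Nat.zero_le β) f
    have h7 := integral_abs_pow_mul_norm_sq_le le_rfl (n := β) f
    have h8 : 0 ≤ ∫ x, (|x| ^ β * ‖u x‖) ^ 2 := integral_nonneg fun x => by positivity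
    have h9 : 0 ≤ ∫ x, ‖iteratedDeriv (2 * j * β) f x‖ ^ 2 :=
      integral_nonneg fun x => by positivity
    have h10 : 0 ≤ ∫ x, (jap x ^ β * ‖f x‖) ^ 2 := integral_nonneg fun x => by positivity
    simp only [pow_zero, one_mul] at h6
    rw [← mul_assoc] at h4
    generalize ∫ x, (jap x ^ β * ‖f x‖) ^ 2 = a at *
    generalize ∫ x, ‖iteratedDeriv (2 * j * β) f x‖ ^ 2 = b at *
    generalize ∫ x, (|x| ^ β * ‖u x‖) ^ 2 = v at *
    generalize ∫ x, ‖f x‖ ^ 2 = m at *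
    have e1 : v ≤ B * (jap t ^ β) ^ 2 * ((2 ^ (2 * (j * β)) + P) * (a + b)) := by
      calc v ≤ P * v := le_mul_of_one_le_left h8 hP
        _ ≤ _ := h2 ▸ h3
        _ ≤ _ := by
          gcongr
          have p2 : (0 : ℝ) ≤ 2 ^ (2 * (j * β)) := by positivity
          rw [h5]
          have := mul_le_mul_of_nonneg_left h7 (zero_le_one.trans hP)
          rw [← mul_assoc 2 j β] at *
          nlinarith [mul_le_mul_of_nonneg_left h6 p2, mul_nonneg (zero_le_one.trans hP) h9]
    have e2 : m ≤ (jap t ^ β) ^ 2 * (a + b) := by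
      nlinarith [one_le_pow₀ hT (n := 2), add_nonneg h10 h9]
    refine h1.trans ?_
    calc _ ≤ 2 ^ β * ((jap t ^ β) ^ 2 * (a + b) +
          B * (jap t ^ β) ^ 2 * ((2 ^ (2 * (j * β)) + P) * (a + b))) := by gcongr
      _ = _ := by rw [hK]; ring
  have hT0 : 0 ≤ jap t ^ β := zero_le_one.trans hT
  refine (sq_le_sq₀ ENNReal.toReal_nonneg (by positivity)).1 (hsq.trans ?_)
  rw [mul_pow, mul_pow, Real.sq_sqrt hK0.le]
  gcongr
  nlinarith [mul_nonneg hA hR]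
end
end

section
/- Let α ∈ (0,1), m = [1/α] + 1, and s, j ∈ ℤ⁺ with s − j + 1 ∈ ℤ⁺ and s − 1 ≥ (2/α)j + 3j. There exists C > 0 such that for every T > 0, every λ > 0, and every sufficiently regular u : ℝ × [0,T] → ℝ satisfying ⟨x⟩^m |u(t,x)| ≥ λ/2 for all (t,x) ∈ [0,T] × ℝ, one has ‖ |u|^α ∂_x^{2j−1} u ‖_{L_T^1 L_x^2} ≤ C T ‖u‖_{X_T}^{α+1}. -/
open MeasureTheory Filter Set
open scoped ENNReal NNReal

noncomputable section

/-- `L²(ℝ)` norm, valued in `ℝ≥0∞`. -/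
def eL2 (g : ℝ → ℝ) : ℝ≥0∞ := eLpNorm g 2 volume

/-- `L^∞(ℝ)` norm, valued in `ℝ≥0∞`. -/
def eLinf (g : ℝ → ℝ) : ℝ≥0∞ := eLpNorm g ⊤ volume

/-- Integer Sobolev `H^s(ℝ)` norm (sum of `L²` norms of derivatives up to order `s`). -/
def eHs (s : ℕ) (g : ℝ → ℝ) : ℝ≥0∞ := ∑ k ∈ Finset.range (s + 1), eL2 (iteratedDeriv k g)

/-- `sup_{0 ≤ t ≤ T}` of a time-dependent norm. -/
def eLTinf (T : ℝ) (N : ℝ → ℝ≥0∞) : ℝ≥0∞ := ⨆ t : Set.Icc (0:ℝ) T, N t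

/-- `L²` norm in time on `[0,T]` at a fixed spatial point `x`. -/
def eLT2x (T : ℝ) (F : ℝ → ℝ → ℝ) (x : ℝ) : ℝ≥0∞ :=
  (∫⁻ t in Set.Ioc (0:ℝ) T, (‖F t x‖₊ : ℝ≥0∞) ^ 2) ^ (1/2 : ℝ)

/-- The mixed norm `‖F‖_{L_T^1 L_x^2}`. -/
def eLT1L2 (T : ℝ) (F : ℝ → ℝ → ℝ) : ℝ≥0∞ := ∫⁻ t in Set.Ioc (0:ℝ) T, eL2 (F t)

/-- The mixed norm `‖F‖_{L_x^q L_T^2}`. -/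
def eLxqLT2 (q T : ℝ) (F : ℝ → ℝ → ℝ) : ℝ≥0∞ :=
  (∫⁻ x : ℝ, eLT2x T F x ^ q) ^ (1 / q)

/-- The mixed norm `‖F‖_{L_x^∞ L_T^2}`. -/
def eLxInfLT2 (T : ℝ) (F : ℝ → ℝ → ℝ) : ℝ≥0∞ := ⨆ x : ℝ, eLT2x T F x

/-- The norm `‖u‖_{X_T}` of the resolution space:
`‖u‖_{L_T^∞ H^s} + ‖⟨x⟩^m u‖_{L_T^∞ L_x^∞} + Σ_{γ=1}^{2j+2} ‖⟨x⟩^m ∂_x^γ u‖_{L_T^∞ L_x^2}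
 + Σ_{l=0}^{j-1} ‖∂_x^{s+j-l} u‖_{L_x^∞ L_T^2}`. -/
def XT (s j m : ℕ) (T : ℝ) (u : ℝ → ℝ → ℝ) : ℝ≥0∞ :=
  eLTinf T (fun t => eHs s (u t))
  + eLTinf T (fun t => eLinf (fun x => jap x ^ m * u t x))
  + ∑ γ ∈ Finset.Icc 1 (2 * j + 2),
      eLTinf T (fun t => eL2 (fun x => jap x ^ m * iteratedDeriv γ (u t) x))
  + ∑ l ∈ Finset.range j,
      eLxInfLT2 T (fun t x => iteratedDeriv (s + j - l) (u t) x)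

/-- The nonlinearity `|u|^α ∂_x^{2j-1} u`. -/
def nonlin (α : ℝ) (j : ℕ) (u : ℝ → ℝ → ℝ) : ℝ → ℝ → ℝ :=
  fun t x => |u t x| ^ α * iteratedDeriv (2 * j - 1) (u t) x

lemma one_le_jap_pow (m : ℕ) (x : ℝ) : 1 ≤ jap x ^ m :=
  one_le_pow₀ (Real.one_le_sqrt.2 (by nlinarith [sq_nonneg x]))

/-- Hölder's inequality for `|f|^α g`, with weights `⟨x⟩^m` added on the right. -/
lemma eL2_rpow_abs_mul_le {α : ℝ} (hα : 0 ≤ α) (m : ℕ) (f g : ℝ → ℝ)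
    (hf : eLinf (fun x => jap x ^ m * f x) ≠ ⊤) :
    eL2 (fun x => |f x| ^ α * g x)
      ≤ eLinf (fun x => jap x ^ m * f x) ^ α * eL2 (fun x => jap x ^ m * g x) := by
  set K := eLinf (fun x => jap x ^ m * f x) with hK
  have hae : ∀ᵐ x : ℝ, ‖jap x ^ m * f x‖ₑ ≤ K := by
    simpa only [hK, eLinf, eLpNorm_exponent_top] using
      enorm_ae_le_eLpNormEssSup (fun x => jap x ^ m * f x) volume
  have key := eLpNorm_le_nnreal_smul_eLpNorm_of_ae_le_mul (μ := volume) (c := K.toNNReal ^ α)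
    (f := fun x => |f x| ^ α * g x) (g := fun x => jap x ^ m * g x) (by
      filter_upwards [hae] with x hx
      have h1 := one_le_jap_pow m x
      have h2 : |f x| ≤ K.toNNReal := by
        have h3 : ‖jap x ^ m * f x‖₊ ≤ K.toNNReal := by
          rwa [← ENNReal.coe_le_coe, ENNReal.coe_toNNReal hf]
        have h4 : |jap x ^ m * f x| ≤ K.toNNReal := by exact_mod_cast h3
        rw [abs_mul, abs_of_nonneg (zero_le_one.trans h1)] at h4
        exact (le_mul_of_one_le_left (abs_nonneg _) h1).trans h4
      rw [← NNReal.coe_le_coe]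
      push_cast
      rw [Real.norm_eq_abs, Real.norm_eq_abs, abs_mul, abs_mul,
        abs_of_nonneg (Real.rpow_nonneg (abs_nonneg _) _), abs_of_nonneg (zero_le_one.trans h1)]
      exact mul_le_mul (Real.rpow_le_rpow (abs_nonneg _) h2 hα)
        (le_mul_of_one_le_left (abs_nonneg _) h1) (abs_nonneg _) (by positivity)) 2
  rwa [ENNReal.smul_def, smul_eq_mul, ENNReal.coe_rpow_of_nonneg _ hα,
    ENNReal.coe_toNNReal hf] at key

lemma eLinf_weighted_le_XT (s j m : ℕ) {T : ℝ} (u : ℝ → ℝ → ℝ) {t : ℝ} (ht : t ∈ Icc 0 T) :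
    eLinf (fun x => jap x ^ m * u t x) ≤ XT s j m T u :=
  (le_iSup (fun t : Icc (0:ℝ) T => eLinf (fun x => jap x ^ m * u t x)) ⟨t, ht⟩).trans
    (le_add_self.trans (le_self_add.trans le_self_add))

lemma eL2_weighted_iteratedDeriv_le_XT (s : ℕ) {j γ : ℕ} (hγ : γ ∈ Finset.Icc 1 (2 * j + 2))
    (m : ℕ) {T : ℝ} (u : ℝ → ℝ → ℝ) {t : ℝ} (ht : t ∈ Icc 0 T) :
    eL2 (fun x => jap x ^ m * iteratedDeriv γ (u t) x) ≤ XT s j m T u :=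
  calc
    _ ≤ eLTinf T (fun t => eL2 (fun x => jap x ^ m * iteratedDeriv γ (u t) x)) :=
      le_iSup (fun t : Icc (0:ℝ) T => eL2 (fun x => jap x ^ m * iteratedDeriv γ (u t) x)) ⟨t, ht⟩
    _ ≤ ∑ γ ∈ Finset.Icc 1 (2 * j + 2),
        eLTinf T (fun t => eL2 (fun x => jap x ^ m * iteratedDeriv γ (u t) x)) :=
      Finset.single_le_sum
        (f := fun γ => eLTinf T (fun t => eL2 (fun x => jap x ^ m * iteratedDeriv γ (u t) x)))
        (fun _ _ => zero_le) hγ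
    _ ≤ XT s j m T u := le_add_self.trans le_self_add

/-- **Nonlinear estimate (3.1)**: `‖|u|^α ∂_x^{2j-1} u‖_{L_T^1 L_x^2} ≤ C T ‖u‖_{X_T}^{α+1}`. -/
theorem nonlinear_estimate_31 (α : ℝ) (hα : α ∈ Set.Ioo (0:ℝ) 1) (m : ℕ)
    (hm : m = ⌊1 / α⌋₊ + 1) (s j : ℕ) (hj : 1 ≤ j) (hjs : j ≤ s)
    (hs : (s : ℝ) - 1 ≥ (2 / α) * j + 3 * j) :
    ∃ C : ℝ, 0 < C ∧ ∀ T : ℝ, 0 < T → ∀ lam : ℝ, 0 < lam → ∀ u : ℝ → ℝ → ℝ,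
      ContDiff ℝ (⊤ : ℕ∞) (Function.uncurry u) →
      (∀ t ∈ Set.Icc (0:ℝ) T, ∀ x : ℝ, lam / 2 ≤ jap x ^ m * |u t x|) →
      eLT1L2 T (nonlin α j u) ≤ ENNReal.ofReal (C * T) * XT s j m T u ^ (α + 1) := by
  obtain ⟨hα0, -⟩ := hα
  refine ⟨1, one_pos, fun T hT _ _ u _ _ => ?_⟩
  rw [one_mul]
  rcases eq_or_ne (XT s j m T u) ⊤ with hX | hX
  · rw [hX, ENNReal.top_rpow_of_pos (by linarith), ENNReal.mul_top (by simpa using hT)]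
    exact le_top
  have hpt : ∀ t ∈ Ioc (0:ℝ) T, eL2 (nonlin α j u t) ≤ XT s j m T u ^ (α + 1) := by
    intro t ht
    have ht' := Ioc_subset_Icc_self ht
    have hinf := eLinf_weighted_le_XT s j m u ht'
    refine (eL2_rpow_abs_mul_le hα0.le m (u t) _ (ne_top_of_le_ne_top hX hinf)).trans ?_
    rw [ENNReal.rpow_add_of_nonneg _ _ hα0.le zero_le_one, ENNReal.rpow_one]
    exact mul_le_mul' (ENNReal.rpow_le_rpow hinf hα0.le)
      (eL2_weighted_iteratedDeriv_le_XT s (Finset.mem_Icc.2 (by omega)) m u ht')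
  calc eLT1L2 T (nonlin α j u)
      ≤ ∫⁻ _ in Ioc (0:ℝ) T, XT s j m T u ^ (α + 1) :=
        setLIntegral_mono' measurableSet_Ioc hpt
    _ = ENNReal.ofReal T * XT s j m T u ^ (α + 1) := by
        rw [setLIntegral_const, Real.volume_Ioc, sub_zero, mul_comm]
end
end
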